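/- arXiv:math/0503095 — 5 statements merged into one kernel-verified Lean document; each statement's English description precedes it below -/
import Mathlib

section
/- Let p be an odd prime and let k be an integer with 2 ≤ k ≤ ⌊(p+1)/3⌋ + 1. Let S be a sequence in Z_p of length 2p−k that has no zero-sum subsequence of length p (i.e., 0 ∉ Σ_p(S)). Then there exist two distinct elements a, b ∈ Z_p such that v_a(S) ≥ v_b(S) and v_a(S) + v_b(S) ≥ 2p − 2k + 2; that is, S can be arranged as (a^u, b^v, a_1', …, a_{2p−k−u−v}') with u ≥ v, u + v ≥ 2p − 2k + 2, and a − b generating Z_p. -/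
open Finset Pointwise

/-- The set of sums of all subsequences of `T` (the empty one included). -/
def subsums {p : ℕ} (T : Multiset (ZMod p)) : Finset (ZMod p) :=
  (T.powerset.map Multiset.sum).toFinset

/-- The set `Σ_m(T)` of sums of subsequences of `T` of length `m`. -/
def subsumsOfCard {p : ℕ} (m : ℕ) (T : Multiset (ZMod p)) : Finset (ZMod p) :=
  ((T.powersetCard m).map Multiset.sum).toFinset

/-- No nonempty subsequence of `T` has sum zero. -/
def ZeroSumFree {p : ℕ} (T : Multiset (ZMod p)) : Prop :=
  ∀ W ≤ T, W.sum = 0 → W = 0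

theorem mem_subsums {p : ℕ} {T : Multiset (ZMod p)} {x : ZMod p} :
    x ∈ subsums T ↔ ∃ W ≤ T, W.sum = x := by
  simp [subsums]

theorem mem_subsumsOfCard {p m : ℕ} {T : Multiset (ZMod p)} {x : ZMod p} :
    x ∈ subsumsOfCard m T ↔ ∃ W ≤ T, Multiset.card W = m ∧ W.sum = x := by
  simp [subsumsOfCard, and_assoc]

/-- If no element of `S` occurs more than `m` times, then `S` partitions into `m` nonempty sets,
so the Cauchy–Davenport theorem bounds `Σ_m(S)` from below. -/
theorem min_le_card_subsumsOfCard {p : ℕ} (hp : p.Prime) (m : ℕ) (S : Multiset (ZMod p))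
    (hcount : ∀ x, S.count x ≤ m) (hm : m ≤ Multiset.card S) :
    min p (Multiset.card S - m + 1) ≤ #(subsumsOfCard m S) := by
  induction m generalizing S with
  | zero =>
    have hS : S = 0 := Multiset.eq_zero_of_forall_notMem fun x hx => by
      have := hcount x
      have := Multiset.count_pos.2 hx
      omega
    subst hS
    have h1 : 1 ≤ #(subsumsOfCard 0 (0 : Multiset (ZMod p))) :=
      Finset.card_pos.2 ⟨0, mem_subsumsOfCard.2 ⟨0, le_rfl, by simp⟩⟩
    simpa using Or.inr h1
  | succ m ih =>
    obtain ⟨A, hA, hAS, hcA, hmA⟩ : ∃ A : Finset (ZMod p), A.Nonempty ∧ A.val ≤ S ∧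
        (∀ x, S.count x = m + 1 → x ∈ A) ∧ #A + m ≤ Multiset.card S := by
      by_cases hM : ∃ x, S.count x = m + 1
      · obtain ⟨x, hx⟩ := hM
        refine ⟨S.toFinset.filter fun x => S.count x = m + 1, ⟨x, ?_⟩, ?_, ?_, ?_⟩
        · simp only [Finset.mem_filter, Multiset.mem_toFinset, hx, and_true]
          exact Multiset.count_pos.1 (by omega)
        · exact (Multiset.le_iff_subset (Finset.nodup _)).2 fun y hy => by
            simpa using (Finset.mem_filter.1 hy).1
        · intro y hy
          simp only [Finset.mem_filter, Multiset.mem_toFinset, hy, and_true]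
          exact Multiset.count_pos.1 (by omega)
        · set A := S.toFinset.filter fun x => S.count x = m + 1 with hA
          have hxA : x ∈ A := by
            simp only [hA, Finset.mem_filter, Multiset.mem_toFinset, hx, and_true]
            exact Multiset.count_pos.1 (by omega)
          have h1 : 1 ≤ #A := Finset.card_pos.2 ⟨x, hxA⟩
          have h2 : #A * (m + 1) ≤ Multiset.card S := by
            rw [← Multiset.toFinset_sum_count_eq S]
            calc #A * (m + 1) = ∑ y ∈ A, S.count y := by
                  rw [Finset.sum_congr rfl fun y hy => (Finset.mem_filter.1 hy).2]
                  simp [hA]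
              _ ≤ _ := Finset.sum_le_sum_of_subset (Finset.filter_subset _ _)
          nlinarith
      · push Not at hM
        obtain ⟨x, hx⟩ := Multiset.card_pos_iff_exists_mem.1 (show 0 < Multiset.card S by omega)
        exact ⟨{x}, ⟨x, by simp⟩, by simpa using hx, fun y hy => absurd hy (hM y), by
          simp; omega⟩
    have hcard : Multiset.card (S - A.val) = Multiset.card S - #A := Multiset.card_sub hAS
    have ih' := ih (S - A.val) (fun x => by
      rw [Multiset.count_sub]
      have h1 := hcount x
      by_cases hx : S.count x = m + 1
      · have := Multiset.count_pos.2 (show x ∈ A.val from hcA x hx)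
        omega
      · omega) (by omega)
    have hsub : A + subsumsOfCard m (S - A.val) ⊆ subsumsOfCard (m + 1) S := by
      intro z hz
      obtain ⟨x, hx, y, hy, rfl⟩ := Finset.mem_add.1 hz
      obtain ⟨W, hW, hWc, rfl⟩ := mem_subsumsOfCard.1 hy
      refine mem_subsumsOfCard.2 ⟨x ::ₘ W, ?_, by simp [hWc], by simp⟩
      calc x ::ₘ W = {x} + W := (Multiset.singleton_add x W).symm
        _ ≤ A.val + (S - A.val) := add_le_add (Multiset.singleton_le.2 hx) hW
        _ = S := add_tsub_cancel_of_le hAS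
    have hne : (subsumsOfCard m (S - A.val)).Nonempty := by
      rw [← Finset.card_pos]
      have := hp.pos
      omega
    have hCD := ZMod.cauchy_davenport hp hA hne
    have := Finset.card_le_card hsub
    have := hA.card_pos
    omega

theorem ZeroSumFree.mono {p : ℕ} {T T' : Multiset (ZMod p)} (hT : ZeroSumFree T) (h : T' ≤ T) :
    ZeroSumFree T' := fun W hW => hT W (hW.trans h)

theorem ZeroSumFree.ne_zero {p : ℕ} {T : Multiset (ZMod p)} (hT : ZeroSumFree T) {x : ZMod p}
    (hx : x ∈ T) : x ≠ 0 := fun h => by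
  simpa using hT {x} (Multiset.singleton_le.2 hx) (by simpa using h)

theorem zero_mem_subsums {p : ℕ} (T : Multiset (ZMod p)) : (0 : ZMod p) ∈ subsums T :=
  mem_subsums.2 ⟨0, Multiset.zero_le _, by simp⟩

theorem card_subsums_le {p : ℕ} (hp : p.Prime) (T : Multiset (ZMod p)) : #(subsums T) ≤ p := by
  have : Fact p.Prime := ⟨hp⟩
  simpa [ZMod.card] using Finset.card_le_univ (subsums T)

/-- For zero-sum free sequences the number of nonempty subsums is superadditive. -/
theorem ZeroSumFree.card_subsums_add {p : ℕ} (hp : p.Prime) {A B : Multiset (ZMod p)}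
    (h : ZeroSumFree (A + B)) :
    #(subsums A) + #(subsums B) ≤ #(subsums (A + B)) + 1 := by
  have : Fact p.Prime := ⟨hp⟩
  have hsub : subsums A + subsums B ⊆ subsums (A + B) := by
    intro z hz
    obtain ⟨x, hx, y, hy, rfl⟩ := Finset.mem_add.1 hz
    obtain ⟨V, hV, rfl⟩ := mem_subsums.1 hx
    obtain ⟨W, hW, rfl⟩ := mem_subsums.1 hy
    exact mem_subsums.2 ⟨V + W, add_le_add hV hW, by simp⟩
  have hCD := ZMod.cauchy_davenport hp ⟨0, zero_mem_subsums A⟩ ⟨0, zero_mem_subsums B⟩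
  have hle := Finset.card_le_card hsub
  have hkey : #(subsums A) + #(subsums B) ≤ p + 1 := by
    have hinter : subsums A ∩ -subsums B ⊆ {0} := by
      intro x hx
      obtain ⟨hxA, hxB⟩ := Finset.mem_inter.1 hx
      obtain ⟨V, hV, rfl⟩ := mem_subsums.1 hxA
      obtain ⟨W, hW, hWs⟩ := mem_subsums.1 (Finset.mem_neg'.1 hxB)
      have h0 := h (V + W) (add_le_add hV hW) (by simp [hWs])
      have hV0 : V = 0 := by
        have := congrArg Multiset.card h0
        simp only [Multiset.card_add, Multiset.card_zero] at this
        exact Multiset.card_eq_zero.1 (by omega)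
      simp [hV0]
    have h1 := Finset.card_le_card hinter
    have h2 := Finset.card_union_add_card_inter (subsums A) (-subsums B)
    have h3 : #(subsums A ∪ -subsums B) ≤ p := by
      simpa [ZMod.card] using Finset.card_le_univ (subsums A ∪ -subsums B)
    rw [Finset.card_neg] at h2
    rw [Finset.card_singleton] at h1
    omega
  omega

theorem ZeroSumFree.card_lt_card_subsums {p : ℕ} (hp : p.Prime) {T : Multiset (ZMod p)}
    (h : ZeroSumFree T) : Multiset.card T + 1 ≤ #(subsums T) := by
  induction T using Multiset.induction_on with
  | empty => exact Finset.card_pos.2 ⟨0, zero_mem_subsums _⟩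
  | cons x T ih =>
    have ih' := ih (h.mono (Multiset.le_cons_self T x))
    have hx : ({0, x} : Finset (ZMod p)) ⊆ subsums {x} := by
      intro y hy
      rcases Finset.mem_insert.1 hy with rfl | hy
      · exact zero_mem_subsums _
      · exact mem_subsums.2 ⟨{x}, le_rfl, by simpa using (Finset.mem_singleton.1 hy).symm⟩
    have hx2 := Finset.card_le_card hx
    rw [Finset.card_pair (h.ne_zero (Multiset.mem_cons_self x T)).symm] at hx2
    rw [← Multiset.singleton_add] at h ⊢
    have := h.card_subsums_add hp
    simp only [Multiset.card_add, Multiset.card_singleton]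
    omega

theorem ZeroSumFree.card_add_le {p : ℕ} (hp : p.Prime) {A T : Multiset (ZMod p)}
    (h : ZeroSumFree T) (hA : A ≤ T) :
    #(subsums A) + Multiset.card T ≤ #(subsums T) + Multiset.card A := by
  obtain ⟨B, rfl⟩ := Multiset.le_iff_exists_add.1 hA
  have h1 := h.card_subsums_add hp
  have h2 := (h.mono (Multiset.le_add_left B A)).card_lt_card_subsums hp
  simp only [Multiset.card_add]
  omega

theorem ZeroSumFree.four_le_card_subsums_pair {p : ℕ} {x y : ZMod p}
    (h : ZeroSumFree ({x, y} : Multiset (ZMod p))) (hxy : x ≠ y) :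
    4 ≤ #(subsums ({x, y} : Multiset (ZMod p))) := by
  have hx : x ≠ 0 := h.ne_zero (by simp)
  have hy : y ≠ 0 := h.ne_zero (by simp)
  have hxy0 : x + y ≠ 0 := fun h0 => by simpa using h {x, y} le_rfl (by simpa using h0)
  have hsub : ({0, x, y, x + y} : Finset (ZMod p)) ⊆ subsums ({x, y} : Multiset (ZMod p)) := by
    intro z hz
    simp only [Finset.mem_insert, Finset.mem_singleton] at hz
    rcases hz with rfl | rfl | rfl | rfl
    · exact zero_mem_subsums _
    · exact mem_subsums.2 ⟨{z}, by simp, by simp⟩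
    · exact mem_subsums.2 ⟨{z}, by simp, by simp⟩
    · exact mem_subsums.2 ⟨{x, y}, le_rfl, by simp⟩
  refine le_trans (le_of_eq ?_) (Finset.card_le_card hsub)
  rw [Finset.card_insert_of_notMem, Finset.card_insert_of_notMem, Finset.card_pair]
  · simpa using hx
  · simp [hxy, hy]
  · simp [hx.symm, hy.symm, hxy0.symm]

theorem ZeroSumFree.six_le_card_subsums_triple {p : ℕ} (hp : p.Prime) (hodd : Odd p)
    {x y z : ZMod p} (h : ZeroSumFree ({x, y, z} : Multiset (ZMod p)))
    (hxy : x ≠ y) (hxz : x ≠ z) (hyz : y ≠ z) :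
    6 ≤ #(subsums ({x, y, z} : Multiset (ZMod p))) := by
  have : Fact p.Prime := ⟨hp⟩
  wlog hne : x + y ≠ z generalizing x y z
  · push Not at hne
    have h' : ({x, z, y} : Multiset (ZMod p)) = {x, y, z} := by
      rw [Multiset.insert_eq_cons, Multiset.pair_comm, ← Multiset.insert_eq_cons]
    rw [← h'] at h ⊢
    refine this h hxz hxy hyz.symm fun h2 => ?_
    have h20 : (2 : ZMod p) * x = 0 := by linear_combination h2 + hne
    have hx : x ≠ 0 := h.ne_zero (by simp)
    have h2ne : (2 : ZMod p) ≠ 0 := by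
      intro h0
      have : p ∣ 2 := (ZMod.natCast_eq_zero_iff 2 p).1 (by exact_mod_cast h0)
      have := (Nat.prime_dvd_prime_iff_eq hp Nat.prime_two).1 this
      subst this
      exact absurd hodd (by decide)
    exact (mul_ne_zero h2ne hx) h20
  have hx : x ≠ 0 := h.ne_zero (by simp)
  have hy : y ≠ 0 := h.ne_zero (by simp)
  have hz : z ≠ 0 := h.ne_zero (by simp)
  have hxyl : ({x, y} : Multiset (ZMod p)) ≤ {x, y, z} := by
    simp only [Multiset.insert_eq_cons]
    exact Multiset.cons_le_cons _ (by simp)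
  have hyzl : ({y, z} : Multiset (ZMod p)) ≤ {x, y, z} := Multiset.le_cons_self _ _
  have hxzl : ({x, z} : Multiset (ZMod p)) ≤ {x, y, z} := by
    simp only [Multiset.insert_eq_cons]
    exact Multiset.cons_le_cons _ (Multiset.le_cons_self _ _)
  have hxy0 : x + y ≠ 0 := fun h0 => by simpa using h {x, y} hxyl (by simpa using h0)
  have hyz0 : y + z ≠ 0 := fun h0 => by simpa using h {y, z} hyzl (by simpa using h0)
  have hxz0 : x + z ≠ 0 := fun h0 => by simpa using h {x, z} hxzl (by simpa using h0)
  have hxyz0 : x + y + z ≠ 0 := fun h0 => by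
    simpa using h {x, y, z} le_rfl (by simpa [add_assoc] using h0)
  have hsub : ({0, x, y, z, x + y, x + y + z} : Finset (ZMod p)) ⊆
      subsums ({x, y, z} : Multiset (ZMod p)) := by
    intro w hw
    simp only [Finset.mem_insert, Finset.mem_singleton] at hw
    rcases hw with rfl | rfl | rfl | rfl | rfl | rfl
    · exact zero_mem_subsums _
    · exact mem_subsums.2 ⟨{w}, by simp, by simp⟩
    · exact mem_subsums.2 ⟨{w}, by simp, by simp⟩
    · exact mem_subsums.2 ⟨{w}, by simp, by simp⟩
    · exact mem_subsums.2 ⟨{x, y}, hxyl, by simp⟩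
    · exact mem_subsums.2 ⟨{x, y, z}, le_rfl, by simp [add_assoc]⟩
  refine le_trans (le_of_eq ?_) (Finset.card_le_card hsub)
  have e1 : x ≠ x + y + z := fun h => hyz0 (by linear_combination -h)
  have e2 : y ≠ x + y + z := fun h => hxz0 (by linear_combination -h)
  have e3 : z ≠ x + y + z := fun h => hxy0 (by linear_combination -h)
  rw [Finset.card_insert_of_notMem, Finset.card_insert_of_notMem, Finset.card_insert_of_notMem,
    Finset.card_insert_of_notMem, Finset.card_pair]
  · simpa using hz
  · simp [hne.symm, e3]
  · simp [hyz, hx, e2]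
  · simp [hxy, hxz, hy, e1]
  · simp [hx.symm, hy.symm, hz.symm, hxy0.symm, hxyz0.symm]

/-- A zero-sum free sequence with few subsums is dominated by a single element. -/
theorem ZeroSumFree.exists_card_le_count_add {p : ℕ} (hp : p.Prime) (hodd : Odd p) (e : ℕ)
    (R : Multiset (ZMod p)) (h : ZeroSumFree R) (hle : #(subsums R) ≤ Multiset.card R + 1 + e)
    (he : 2 * e + 1 ≤ Multiset.card R) : ∃ b ∈ R, Multiset.card R ≤ R.count b + e := by
  induction e generalizing R with
  | zero =>
    obtain ⟨x, hx⟩ := Multiset.card_pos_iff_exists_mem.1 (show 0 < Multiset.card R by omega)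
    refine ⟨x, hx, ?_⟩
    rw [add_zero, Multiset.count_eq_card.2]
    intro y hy
    by_contra hxy
    have hpair : ({x, y} : Multiset (ZMod p)) ≤ R :=
      (Multiset.le_iff_subset (by simp [hxy])).2 fun z hz => by
        simp only [Multiset.insert_eq_cons, Multiset.mem_cons, Multiset.mem_singleton] at hz
        rcases hz with rfl | rfl <;> assumption
    have h1 := h.card_add_le hp hpair
    have h2 := (h.mono hpair).four_le_card_subsums_pair hxy
    simp only [Multiset.insert_eq_cons, Multiset.card_cons, Multiset.card_singleton] at h1 h2
    omega
  | succ e ih =>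
    obtain ⟨x₀, hx₀⟩ := Multiset.card_pos_iff_exists_mem.1 (show 0 < Multiset.card R by omega)
    obtain ⟨x, hxR, hxmax⟩ := Finset.exists_max_image R.toFinset (fun z => R.count z)
      ⟨x₀, Multiset.mem_toFinset.2 hx₀⟩
    rw [Multiset.mem_toFinset] at hxR
    by_cases hall : ∀ y ∈ R, x = y
    · exact ⟨x, hxR, by rw [Multiset.count_eq_card.2 hall]; omega⟩
    push Not at hall
    obtain ⟨y₀, hy₀, hxy₀⟩ := hall
    obtain ⟨y, hyR, hymax⟩ := Finset.exists_max_image (R.toFinset.erase x) (fun z => R.count z)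
      ⟨y₀, by simp [hy₀, hxy₀.symm]⟩
    simp only [Finset.mem_erase, Multiset.mem_toFinset] at hyR hymax hxmax
    obtain ⟨hyx, hyR⟩ := hyR
    have hpair : ({x, y} : Multiset (ZMod p)) ≤ R :=
      (Multiset.le_iff_subset (by simp [hyx.symm])).2 fun z hz => by
        simp only [Multiset.insert_eq_cons, Multiset.mem_cons, Multiset.mem_singleton] at hz
        rcases hz with rfl | rfl <;> assumption
    obtain ⟨R', rfl⟩ := Multiset.le_iff_exists_add.1 hpair
    have h1 := h.card_subsums_add hp
    have h2 := (h.mono hpair).four_le_card_subsums_pair hyx.symm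
    have hc : Multiset.card ({x, y} + R') = 2 + Multiset.card R' := by
      simp; omega
    obtain ⟨b, hb, hbc⟩ := ih R' (h.mono (Multiset.le_add_left _ _)) (by omega) (by omega)
    have hbmem : b ∈ ({x, y} : Multiset (ZMod p)) + R' := Multiset.mem_add.2 (Or.inr hb)
    refine ⟨b, hbmem, ?_⟩
    have hcount := Multiset.count_add b ({x, y} : Multiset (ZMod p)) R'
    by_cases hbxy : b ∈ ({x, y} : Multiset (ZMod p))
    · have := Multiset.count_pos.2 hbxy
      omega
    have hbx : b ≠ x := fun hh => hbxy (by simp [hh])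
    have hby : b ≠ y := fun hh => hbxy (by simp [hh])
    have hb1 := hymax b ⟨hbx, hbmem⟩
    have hb2 := hxmax y hyR
    have hsum : Multiset.count x ({x, y} + R') + Multiset.count y ({x, y} + R')
        + Multiset.count b ({x, y} + R') ≤ Multiset.card ({x, y} + R') := by
      have := Finset.sum_le_sum_of_subset (f := fun z => Multiset.count z ({x, y} + R'))
        (show ({x, y, b} : Finset (ZMod p)) ⊆ Multiset.toFinset ({x, y} + R') by
          intro z hz
          simp only [Finset.mem_insert, Finset.mem_singleton] at hz
          rw [Multiset.mem_toFinset]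
          rcases hz with rfl | rfl | rfl <;> assumption)
      rw [Multiset.toFinset_sum_count_eq, Finset.sum_insert (by simp [hyx.symm, hbx.symm]),
        Finset.sum_pair hby.symm] at this
      omega
    have htriple : ({x, y, b} : Multiset (ZMod p)) ≤ {x, y} + R' := by
      refine (Multiset.le_iff_subset (by simp [hyx.symm, hbx.symm, hby.symm])).2 fun z hz => ?_
      simp only [Multiset.insert_eq_cons, Multiset.mem_cons, Multiset.mem_singleton] at hz
      rcases hz with rfl | rfl | rfl <;> assumption
    have h6 := (h.mono htriple).six_le_card_subsums_triple hp hodd hyx.symm hbx.symm hby.symm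
    have h7 := h.card_add_le hp htriple
    have hc3 : Multiset.card ({x, y, b} : Multiset (ZMod p)) = 3 := rfl
    omega

theorem natCast_sum_map_val {p : ℕ} [NeZero p] (M : Multiset (ZMod p)) :
    (((M.map ZMod.val).sum : ℕ) : ZMod p) = M.sum := by
  induction M using Multiset.induction_on with
  | empty => simp
  | cons x M ih => simp [ih]

/-- In a zero-sum free sequence with few subsums, all elements are small multiples of a
frequent element. -/
theorem ZeroSumFree.val_le_count_one {p : ℕ} (hp : p.Prime) {e v : ℕ}
    {C : Multiset (ZMod p)} (h : ZeroSumFree (Multiset.replicate v 1 + C))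
    (hle : #(subsums (Multiset.replicate v 1 + C)) ≤ v + Multiset.card C + 1 + e)
    (hv : e < v) {c : ZMod p} (hc : c ∈ C) : c.val ≤ v := by
  have : Fact p.Prime := ⟨hp⟩
  by_contra! hcv
  have hcp : c.val + v < p := by
    by_contra! hcp
    have hlt := ZMod.val_lt c
    have h0 := h (Multiset.replicate (p - c.val) 1 + {c})
      (add_le_add (Multiset.replicate_mono _ (by omega)) (Multiset.singleton_le.2 hc))
      (by simp [Nat.cast_sub hlt.le])
    simpa using congrArg Multiset.card h0
  have hA : Multiset.replicate v 1 + {c} ≤ Multiset.replicate v 1 + C :=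
    add_le_add le_rfl (Multiset.singleton_le.2 hc)
  have h1 := h.card_add_le hp hA
  have hsub : (Finset.range (v + 1) ∪ Finset.Ico c.val (c.val + v + 1)).image
      (Nat.cast : ℕ → ZMod p) ⊆ subsums (Multiset.replicate v 1 + {c}) := by
    intro z hz
    obtain ⟨i, hi, rfl⟩ := Finset.mem_image.1 hz
    rcases Finset.mem_union.1 hi with hi | hi
    · rw [Finset.mem_range] at hi
      exact mem_subsums.2 ⟨Multiset.replicate i 1,
        (Multiset.replicate_mono _ (by omega)).trans (Multiset.le_add_right _ _), by simp⟩
    · rw [Finset.mem_Ico] at hi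
      exact mem_subsums.2 ⟨Multiset.replicate (i - c.val) 1 + {c},
        add_le_add (Multiset.replicate_mono _ (by omega)) le_rfl, by
          simp [Nat.cast_sub hi.1]⟩
  have h2 := Finset.card_le_card hsub
  rw [Finset.card_image_of_injOn, Finset.card_union_of_disjoint, Finset.card_range,
    Nat.card_Ico] at h2
  · simp only [Multiset.card_add, Multiset.card_replicate, Multiset.card_singleton] at h1
    omega
  · rw [Finset.disjoint_left]
    intro i hi hi'
    rw [Finset.mem_range] at hi
    rw [Finset.mem_Ico] at hi'
    omega
  · intro i hi j hj hij
    simp only [Finset.coe_union, Finset.coe_range, Finset.coe_Ico, Set.mem_union, Set.mem_Iio,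
      Set.mem_Ico] at hi hj
    have := congrArg ZMod.val hij
    rwa [ZMod.val_natCast_of_lt (by omega), ZMod.val_natCast_of_lt (by omega)] at this

theorem ZeroSumFree.add_sum_val_lt {p : ℕ} (hp : p.Prime) {v : ℕ} {C : Multiset (ZMod p)}
    (h : ZeroSumFree (Multiset.replicate v 1 + C)) (hv : v < p) (hC : ∀ c ∈ C, c.val ≤ v) :
    v + (C.map ZMod.val).sum < p := by
  have : Fact p.Prime := ⟨hp⟩
  induction C using Multiset.induction_on with
  | empty => simpa using hv
  | cons c C ih =>
    have ih' := ih (h.mono (add_le_add le_rfl (Multiset.le_cons_self C c)))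
      fun d hd => hC d (Multiset.mem_cons_of_mem hd)
    have hcv := hC c (Multiset.mem_cons_self c C)
    simp only [Multiset.map_cons, Multiset.sum_cons]
    by_contra! hge
    have h0 := h (Multiset.replicate (p - c.val - (C.map ZMod.val).sum) 1 + c ::ₘ C)
      (add_le_add (Multiset.replicate_mono _ (by omega)) le_rfl) (by
        rw [Multiset.sum_add, Multiset.sum_replicate, Multiset.sum_cons, ← natCast_sum_map_val C,
          nsmul_eq_mul, mul_one, Nat.sub_sub, Nat.cast_sub (by omega)]
        simp)
    simpa using congrArg Multiset.card h0

/-- A sequence of `v` ones and weights in `[2, v]` attains every value up to its total weight,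
by a subsequence that is long. -/
theorem exists_long_subsequence_sum_eq {α : Type*} (f : α → ℕ) (v : ℕ) (C : Multiset α)
    (hC : ∀ c ∈ C, 2 ≤ f c ∧ f c ≤ v) (y : ℕ) (hy : y ≤ v + (C.map f).sum) :
    ∃ j ≤ v, ∃ D ≤ C, j + (D.map f).sum = y ∧
      (y ≤ j + Multiset.card D ∨
        v + 2 * Multiset.card C ≤ j + Multiset.card D + (C.map f).sum) := by
  induction C using Multiset.induction_on generalizing y with
  | empty => exact ⟨y, by simpa using hy, 0, le_rfl, by simp, by simp⟩
  | cons c C ih =>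
    have ih := ih fun d hd => hC d (Multiset.mem_cons_of_mem hd)
    obtain ⟨hc2, hcv⟩ := hC c (Multiset.mem_cons_self c C)
    simp only [Multiset.map_cons, Multiset.sum_cons, Multiset.card_cons] at hy ⊢
    by_cases hlt : y ≤ v + (C.map f).sum
    · obtain ⟨j, hj, D, hD, hsum, hor⟩ := ih y hlt
      exact ⟨j, hj, D, hD.trans (Multiset.le_cons_self C c), hsum, by omega⟩
    · obtain ⟨j, hj, D, hD, hsum, hor⟩ := ih (y - f c) (by omega)
      have hCsum : Multiset.card C ≤ (C.map f).sum := by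
        simpa using Multiset.card_nsmul_le_sum (s := C.map f) (a := 1) fun x hx => by
          obtain ⟨d, hd, rfl⟩ := Multiset.mem_map.1 hx
          exact one_le_two.trans (hC d (Multiset.mem_cons_of_mem hd)).1
      exact ⟨j, hj, c ::ₘ D, Multiset.cons_le_cons c hD, by simp; omega, by simp; omega⟩

theorem natCast_sum_map_sub_val {p : ℕ} [NeZero p] (M : Multiset (ZMod p)) :
    (((M.map fun x => p - x.val).sum : ℕ) : ZMod p) = -M.sum := by
  induction M using Multiset.induction_on with
  | empty => simp
  | cons x M ih =>
    simp only [Multiset.map_cons, Multiset.sum_cons, Nat.cast_add, ih,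
      Nat.cast_sub (ZMod.val_lt x).le, CharP.cast_eq_zero, ZMod.natCast_val, ZMod.cast_id', id]
    ring

theorem two_mul_card_le_count_one_add_sum_val {p : ℕ} (hp : p.Prime) {M : Multiset (ZMod p)}
    (hM : ∀ x ∈ M, x ≠ 0) :
    2 * Multiset.card M ≤ M.count 1 + (M.map ZMod.val).sum := by
  have : Fact p.Prime := ⟨hp⟩
  induction M using Multiset.induction_on with
  | empty => simp
  | cons x M ih =>
    have ih' := ih fun y hy => hM y (Multiset.mem_cons_of_mem hy)
    have hx : x.val ≠ 0 := (ZMod.val_ne_zero x).2 (hM x (Multiset.mem_cons_self x M))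
    simp only [Multiset.card_cons, Multiset.map_cons, Multiset.sum_cons, Multiset.count_cons]
    split_ifs with h1
    · omega
    · have : x.val ≠ 1 := fun h => h1 (by
        rw [← ZMod.natCast_zmod_val x, h, Nat.cast_one])
      omega

/-- If all zero-sum subsequences of a sequence without zeros are short, and the sequence contains
a long sequence of ones and elements with small representatives whose integer sum is less than
`p`, then the element `1` is frequent. -/
theorem two_mul_card_le_of_short_zero_sums {p : ℕ} (hp : p.Prime) {f k v : ℕ}
    {C U : Multiset (ZMod p)}
    (hT : ∀ W ≤ Multiset.replicate v 1 + C + U, W.sum = 0 → Multiset.card W ≤ f)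
    (hf : f + 2 ≤ k) (hk : 3 * k ≤ p + 4) (hcard : p + 1 ≤ v + Multiset.card C + k)
    (hC : ∀ c ∈ C, 2 ≤ c.val ∧ c.val ≤ v) (hsum : v + (C.map ZMod.val).sum < p)
    (hU : ∀ x ∈ U, x ≠ 0) :
    2 * (v + Multiset.card C + Multiset.card U) + 1 ≤
      (Multiset.replicate v 1 + C + U).count 1 + p + f := by
  have : Fact p.Prime := ⟨hp⟩
  have hCcard : 2 * Multiset.card C ≤ (C.map ZMod.val).sum := by
    simpa [mul_comm] using Multiset.card_nsmul_le_sum (s := C.map ZMod.val) (a := 2) fun x hx => by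
      obtain ⟨d, hd, rfl⟩ := Multiset.mem_map.1 hx
      exact (hC d hd).1
  set ρ := v + (C.map ZMod.val).sum with hρ
  have hcancel : ∀ J ≤ U, ∀ Y : ℕ, J.sum = -(Y : ZMod p) → Y ≤ ρ →
      Multiset.card J + Y ≤ f := by
    intro J hJ Y hJY hY
    obtain ⟨j, hj, D, hD, hjD, hlong⟩ := exists_long_subsequence_sum_eq ZMod.val v C hC Y hY
    have h0 := hT (Multiset.replicate j 1 + D + J)
      (add_le_add (add_le_add (Multiset.replicate_mono _ hj) hD) hJ) (by
        rw [Multiset.sum_add, Multiset.sum_add, hJY, ← hjD, ← natCast_sum_map_val D]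
        simp)
    simp only [Multiset.card_add, Multiset.card_replicate] at h0
    omega
  set N := U.filter fun x => p ≤ x.val + ρ with hN
  set P := U.filter fun x => ¬ p ≤ x.val + ρ with hP
  have hNP : N + P = U := Multiset.filter_add_not _ U
  have hNsum : ∀ J ≤ N, (J.map fun x => p - x.val).sum + Multiset.card J ≤ f := by
    intro J hJ
    induction J using Multiset.induction_on with
    | empty => simp
    | cons x J ih =>
      have ih' := ih ((Multiset.le_cons_self J x).trans hJ)
      have hxN : x ∈ N := Multiset.mem_of_le hJ (Multiset.mem_cons_self x J)
      obtain ⟨hxU, hxρ⟩ := Multiset.mem_filter.1 hxN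
      have hx1 := hcancel {x} (Multiset.singleton_le.2 hxU) (p - x.val) (by
        simp [Nat.cast_sub (ZMod.val_lt x).le]) (by omega)
      have hx2 := hcancel (x ::ₘ J) (hJ.trans (Multiset.filter_le _ _))
        (((x ::ₘ J).map fun x => p - x.val).sum) (by rw [natCast_sum_map_sub_val, neg_neg]) (by
          simp only [Multiset.card_singleton] at hx1
          simp only [Multiset.map_cons, Multiset.sum_cons]
          omega)
      omega
  have hPsum : ∀ J ≤ P, ρ + (J.map ZMod.val).sum < p := by
    intro J hJ
    induction J using Multiset.induction_on with
    | empty => simpa using hsum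
    | cons x J ih =>
      have ih' := ih ((Multiset.le_cons_self J x).trans hJ)
      have hxP : x ∈ P := Multiset.mem_of_le hJ (Multiset.mem_cons_self x J)
      obtain ⟨-, hxρ⟩ := Multiset.mem_filter.1 hxP
      by_contra! hge
      set q := ρ + ((x ::ₘ J).map ZMod.val).sum - p with hq
      have hqx : q < x.val := by
        simp only [Multiset.map_cons, Multiset.sum_cons] at hq hge
        omega
      have h0 := hT (Multiset.replicate (v - q) 1 + C + x ::ₘ J)
        (add_le_add (add_le_add (Multiset.replicate_mono _ (by omega)) le_rfl)
          (hJ.trans (Multiset.filter_le _ _))) (by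
        rw [Multiset.sum_add, Multiset.sum_add, ← natCast_sum_map_val C,
          ← natCast_sum_map_val (x ::ₘ J), Multiset.sum_replicate, nsmul_one, ← Nat.cast_add,
          ← Nat.cast_add]
        have : v - q + (C.map ZMod.val).sum + ((x ::ₘ J).map ZMod.val).sum = p := by omega
        rw [this, CharP.cast_eq_zero])
      simp only [Multiset.card_add, Multiset.card_replicate, Multiset.card_cons] at h0
      omega
  have h1 := hNsum N le_rfl
  have h2 := hPsum P le_rfl
  have h3 := two_mul_card_le_count_one_add_sum_val hp (M := P)
    fun x hx => hU x (Multiset.mem_of_le (Multiset.filter_le _ _) hx)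
  have h4 : Multiset.card N ≤ (N.map fun x => p - x.val).sum := by
    simpa using Multiset.card_nsmul_le_sum (s := N.map fun x => p - x.val) (a := 1) fun y hy => by
      obtain ⟨d, -, rfl⟩ := Multiset.mem_map.1 hy
      have := ZMod.val_lt d
      omega
  have h5 : v + P.count 1 ≤ (Multiset.replicate v 1 + C + U).count 1 := by
    rw [← hNP]
    simp only [Multiset.count_add, Multiset.count_replicate_self]
    omega
  have h6 : Multiset.card U = Multiset.card N + Multiset.card P := by
    rw [← hNP, Multiset.card_add]
  omega

/-- If all zero-sum subsequences of a long sequence without zeros are short, then some element is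
frequent. -/
theorem exists_two_mul_card_le_of_short_zero_sums {p : ℕ} (hp : p.Prime) (hodd : Odd p)
    {f k : ℕ} {T : Multiset (ZMod p)} (hT : ∀ W ≤ T, W.sum = 0 → Multiset.card W ≤ f)
    (hf : f + 2 ≤ k) (hk : 3 * k ≤ p + 4) (hcard : p + 1 + f ≤ Multiset.card T + k)
    (hT0 : ∀ x ∈ T, x ≠ 0) :
    ∃ b ≠ 0, 2 * Multiset.card T + 1 ≤ T.count b + p + f := by
  have : Fact p.Prime := ⟨hp⟩
  obtain ⟨U, hU, hUmax⟩ := Finset.exists_max_image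
    (T.powerset.toFinset.filter fun W => W.sum = 0) Multiset.card ⟨0, by simp⟩
  simp only [Finset.mem_filter, Multiset.mem_toFinset, Multiset.mem_powerset] at hU hUmax
  obtain ⟨hUT, hUs⟩ := hU
  have hUf := hT U hUT hUs
  obtain ⟨R, rfl⟩ := Multiset.le_iff_exists_add.1 hUT
  rw [Multiset.card_add] at hcard
  have hR : ZeroSumFree R := fun W hW hWs => by
    have := hUmax (U + W) ⟨add_le_add le_rfl hW, by simp [hUs, hWs]⟩
    rw [Multiset.card_add] at this
    exact Multiset.card_eq_zero.1 (by omega)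
  have hRp := hR.card_lt_card_subsums hp
  have hle := card_subsums_le hp R
  obtain ⟨b, hb, hbc⟩ := hR.exists_card_le_count_add hp hodd (p - 1 - Multiset.card R) R
    (by omega) (by omega)
  have hb0 : b ≠ 0 := hR.ne_zero hb
  refine ⟨b, hb0, ?_⟩
  have hinj : Function.Injective fun x : ZMod p => b⁻¹ * x := mul_right_injective₀ (inv_ne_zero hb0)
  have hback : ∀ {W M : Multiset (ZMod p)}, W ≤ M.map (fun x => b⁻¹ * x) →
      W.map (fun x => b * x) ≤ M := fun {W M} h => by
    simpa [Multiset.map_map, Function.comp_def, mul_inv_cancel_left₀ hb0] using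
      Multiset.map_le_map (f := fun x => b * x) h
  have hcount : ∀ M : Multiset (ZMod p), (M.map fun x => b⁻¹ * x).count 1 = M.count b := fun M => by
    rw [← inv_mul_cancel₀ hb0]
    exact Multiset.count_map_eq_count' _ M hinj b
  set R' := R.map fun x => b⁻¹ * x with hR'
  set U' := U.map fun x => b⁻¹ * x with hU'
  have hR'free : ZeroSumFree R' := fun W hW hWs => by
    have := hR _ (hback hW) (by rw [Multiset.sum_map_mul_left, Multiset.map_id', hWs, mul_zero])
    simpa using this
  set C := R'.filter fun x => x ≠ 1 with hC
  set v := R'.count 1 with hv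
  have hsplit : Multiset.replicate v 1 + C = R' := by
    rw [hv, ← Multiset.filter_eq']
    exact Multiset.filter_add_not _ R'
  have hcardR : v + Multiset.card C = Multiset.card R := by
    have := congrArg Multiset.card hsplit
    simpa [hR'] using this
  have hvc : v = R.count b := hcount R
  rw [← hsplit] at hR'free
  have hCv : ∀ c ∈ C, c.val ≤ v := fun c hc =>
    hR'free.val_le_count_one hp (e := p - 1 - Multiset.card R)
      (by have := card_subsums_le hp (Multiset.replicate v 1 + C); omega) (by omega) hc
  have hC2 : ∀ c ∈ C, 2 ≤ c.val := fun c hc => by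
    have h0 : c.val ≠ 0 := (ZMod.val_ne_zero c).2
      (hR'free.ne_zero (Multiset.mem_add.2 (Or.inr hc)))
    have h1 : c.val ≠ 1 := fun h => (Multiset.mem_filter.1 hc).2 (by
      rw [← ZMod.natCast_zmod_val c, h, Nat.cast_one])
    omega
  have hsum := hR'free.add_sum_val_lt hp (by omega) hCv
  have key := two_mul_card_le_of_short_zero_sums hp (f := f) (k := k) (v := v) (C := C) (U := U')
    (fun W hW hWs => by
      rw [hsplit, hR', hU', ← Multiset.map_add, add_comm R U] at hW
      have := hT _ (hback hW) (by rw [Multiset.sum_map_mul_left, Multiset.map_id', hWs, mul_zero])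
      simpa using this)
    hf hk (by omega) (fun c hc => ⟨hC2 c hc, hCv c hc⟩) hsum (fun x hx => by
      obtain ⟨u, hu, rfl⟩ := Multiset.mem_map.1 hx
      exact mul_ne_zero (inv_ne_zero hb0) (hT0 u (Multiset.mem_add.2 (Or.inl hu))))
  have hcT : (Multiset.replicate v 1 + C + U').count 1 = (U + R).count b := by
    rw [hsplit, hR', hU', ← Multiset.map_add, hcount, add_comm]
  have hcU : Multiset.card U' = Multiset.card U := Multiset.card_map _ _
  rw [hcT, hcU] at key
  rw [Multiset.card_add]
  omega

/-- Theorem 3.1: Let `p` be an odd prime, `2 ≤ k ≤ ⌊(p+1)/3⌋ + 1`, and `S` a sequence in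
`ZMod p` of length `2p - k` with no zero-sum subsequence of length `p`. Then there are two
distinct elements `a b` with `v_a(S) ≥ v_b(S)` and `v_a(S) + v_b(S) ≥ 2p - 2k + 2`
(in `ZMod p`, `a - b` generates iff `a ≠ b`). -/
theorem stmt_0 (p k : ℕ) (hp : p.Prime) (hodd : Odd p)
    (hk2 : 2 ≤ k) (hk : k ≤ (p + 1) / 3 + 1)
    (S : Multiset (ZMod p)) (hcard : Multiset.card S = 2 * p - k)
    (hzs : ¬ ∃ T ≤ S, Multiset.card T = p ∧ T.sum = 0) :
    ∃ a b : ZMod p, a ≠ b ∧ S.count b ≤ S.count a ∧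
      2 * p + 2 - 2 * k ≤ S.count a + S.count b := by
  have : Fact p.Prime := ⟨hp⟩
  have hp3 : 3 ≤ p := by
    have := hp.two_le
    obtain ⟨m, hm⟩ := hodd
    omega
  suffices h : ∃ a b : ZMod p, a ≠ b ∧ 2 * p + 2 - 2 * k ≤ S.count a + S.count b by
    obtain ⟨a, b, hab, h⟩ := h
    rcases le_total (S.count b) (S.count a) with hle | hle
    · exact ⟨a, b, hab, hle, h⟩
    · exact ⟨b, a, hab.symm, hle, by omega⟩
  obtain ⟨a, ha⟩ : ∃ a, p - k < S.count a := by
    by_contra! hall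
    have h1 := min_le_card_subsumsOfCard hp (p - k) S hall (by omega)
    have h2 : subsumsOfCard (p - k) S = Finset.univ :=
      Finset.eq_univ_of_card _ (le_antisymm (Finset.card_le_univ _) (by rw [ZMod.card]; omega))
    obtain ⟨V, hV, hVc, hVs⟩ := mem_subsumsOfCard.1 (h2 ▸ Finset.mem_univ S.sum)
    refine hzs ⟨S - V, tsub_le_self, by rw [Multiset.card_sub hV]; omega, ?_⟩
    have := congrArg Multiset.sum (tsub_add_cancel_of_le hV)
    rw [Multiset.sum_add, hVs] at this
    simpa using this
  have hap : S.count a < p := by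
    by_contra! h
    exact hzs ⟨Multiset.replicate p a, Multiset.le_count_iff_replicate_le.1 h, by simp, by simp⟩
  set Q := S.filter fun x => x ≠ a with hQ
  have hsplit : Multiset.replicate (S.count a) a + Q = S := by
    rw [← Multiset.filter_eq']
    exact Multiset.filter_add_not _ S
  have hQcard : S.count a + Multiset.card Q = 2 * p - k := by
    have := congrArg Multiset.card hsplit
    rw [Multiset.card_add, Multiset.card_replicate] at this
    omega
  obtain ⟨b, hb0, hb⟩ := exists_two_mul_card_le_of_short_zero_sums hp hodd
    (f := p - 1 - S.count a) (k := k) (T := Q.map fun x => x - a)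
    (fun W hW hWs => by
      by_contra! hlt
      have hWQ : W.map (fun x => x + a) ≤ Q := by
        simpa [Multiset.map_map, Function.comp_def] using
          Multiset.map_le_map (f := fun x => x + a) hW
      have hWc : Multiset.card W ≤ Multiset.card Q := by
        simpa using Multiset.card_le_card hW
      refine hzs ⟨Multiset.replicate (p - Multiset.card W) a + W.map (fun x => x + a),
        (add_le_add (Multiset.replicate_mono _ (by omega)) hWQ).trans_eq hsplit, ?_, ?_⟩
      · simp only [Multiset.card_add, Multiset.card_replicate, Multiset.card_map]
        omega
      · rw [Multiset.sum_add, Multiset.sum_map_add, Multiset.map_id', hWs, Multiset.sum_replicate,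
          Multiset.map_const', Multiset.sum_replicate, zero_add, ← add_nsmul,
          Nat.sub_add_cancel (by omega)]
        simp)
    (by omega) (by omega) (by rw [Multiset.card_map]; omega) (fun x hx => by
      obtain ⟨y, hy, rfl⟩ := Multiset.mem_map.1 hx
      exact sub_ne_zero.2 (Multiset.mem_filter.1 hy).2)
  refine ⟨a, b + a, by simpa using hb0, ?_⟩
  have hcount : (Q.map fun x => x - a).count b ≤ S.count (b + a) := by
    have := Multiset.count_map_eq_count' (fun x => x - a) Q (sub_left_injective) (b + a)
    rw [add_sub_cancel_right] at this
    rw [this]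
    exact Multiset.count_le_of_le _ (Multiset.filter_le _ _)
  rw [Multiset.card_map] at hb
  omega
end

section
/- Let p be a prime and let k be an integer with 1 ≤ k ≤ p − 2. Let S be a sequence in Z_p of length p + k such that S has no zero-sum subsequence of length p (i.e., 0 ∉ Σ_p(S)). Then h(S) ≥ k + 1, i.e., some element of Z_p occurs at least k + 1 times in S. -/
open scoped Pointwise

/-- The set of sums of subsequences of length `k` of `S`. -/
def subsequenceSums {p : ℕ} (k : ℕ) (S : Multiset (ZMod p)) : Finset (ZMod p) :=
  ((S.powersetCard k).map Multiset.sum).toFinset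

lemma mem_subsequenceSums {p k : ℕ} {S : Multiset (ZMod p)} {x : ZMod p} :
    x ∈ subsequenceSums k S ↔ ∃ T ≤ S, Multiset.card T = k ∧ T.sum = x := by
  simp [subsequenceSums, Multiset.mem_powersetCard, and_assoc]

/-- A sequence with multiplicities at most `k + 1` and length at least `k + 1` contains a nonempty
set whose removal leaves multiplicities at most `k` and length at least `k`. -/
lemma exists_finset_val_le_count_sub_le {α : Type*} [DecidableEq α] (k : ℕ) (S : Multiset α)
    (hcount : ∀ g, S.count g ≤ k + 1) (hcard : k + 1 ≤ Multiset.card S) :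
    ∃ A : Finset α, A.Nonempty ∧ A.val ≤ S ∧ (∀ g, (S - A.val).count g ≤ k) ∧
      k ≤ Multiset.card (S - A.val) := by
  by_cases hmax : ∃ g, S.count g = k + 1
  · obtain ⟨g, hg⟩ := hmax
    have hgS : g ∈ S := Multiset.count_pos.mp (by omega)
    set A : Finset α := S.toFinset.filter (fun x => S.count x = k + 1) with hA
    have hgA : g ∈ A := by simp [hA, hgS, hg]
    refine ⟨A, ⟨g, hgA⟩, ?_, fun x => ?_, ?_⟩
    · exact (Multiset.le_iff_subset A.nodup).mpr fun x hx => by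
        simpa using (Finset.mem_filter.mp (Finset.mem_def.mpr hx)).1
    · rw [Multiset.count_sub]
      have hx := hcount x
      by_cases hxk : S.count x = k + 1
      · have hxA : x ∈ A.val := by
          have : x ∈ S := Multiset.count_pos.mp (by omega)
          exact Finset.mem_def.mp (by simp [hA, this, hxk])
        have := Multiset.count_pos.mpr hxA
        omega
      · omega
    · have hle := Multiset.count_le_card g (S - A.val)
      rw [Multiset.count_sub, hg, Multiset.count_eq_one_of_mem A.nodup hgA] at hle
      omega
  · push Not at hmax
    obtain ⟨g, hg⟩ := Multiset.card_pos_iff_exists_mem.mp (show 0 < Multiset.card S by omega)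
    have hle : ({g} : Finset α).val ≤ S := by simpa using hg
    refine ⟨{g}, Finset.singleton_nonempty g, hle, fun x => ?_, ?_⟩
    · rw [Multiset.count_sub]
      have h₁ := hcount x
      have h₂ := hmax x
      omega
    · rw [Multiset.card_sub hle]
      simp only [Finset.singleton_val, Multiset.card_singleton]
      omega

lemma add_subsequenceSums_subset {p k : ℕ} {S : Multiset (ZMod p)} {A : Finset (ZMod p)}
    (hA : A.val ≤ S) :
    A + subsequenceSums k (S - A.val) ⊆ subsequenceSums (k + 1) S := by
  intro x hx
  obtain ⟨a, ha, b, hb, rfl⟩ := Finset.mem_add.mp hx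
  obtain ⟨T, hT, hTcard, rfl⟩ := mem_subsequenceSums.mp hb
  refine mem_subsequenceSums.mpr ⟨{a} + T, ?_, by simp [hTcard, add_comm], by simp⟩
  calc {a} + T ≤ A.val + (S - A.val) := add_le_add (Multiset.singleton_le.mpr ha) hT
    _ = S := add_tsub_cancel_of_le hA

/-- If every multiplicity of `S` is at most `k ≤ |S|`, then the sums of `k` terms of `S` take at
least `min p (|S| - k + 1)` values. -/
lemma min_le_card_subsequenceSums {p : ℕ} (hp : p.Prime) (k : ℕ) (S : Multiset (ZMod p))
    (hcount : ∀ g, S.count g ≤ k) (hcard : k ≤ Multiset.card S) :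
    min p (Multiset.card S - k + 1) ≤ (subsequenceSums k S).card := by
  induction k generalizing S with
  | zero =>
    have hS : S = 0 := Multiset.eq_zero_of_forall_notMem fun g hg => by
      have := Multiset.count_pos.mpr hg
      have := hcount g
      omega
    subst hS
    simp [subsequenceSums]
  | succ k ih =>
    obtain ⟨A, hne, hAS, hcount', hcard'⟩ :=
      exists_finset_val_le_count_sub_le k S hcount hcard
    have hsums := ih (S - A.val) hcount' hcard'
    have hpos := hp.pos
    have hne' : (subsequenceSums k (S - A.val)).Nonempty := Finset.card_pos.mp (by omega)
    have hcd := ZMod.cauchy_davenport hp hne hne'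
    have hsub := Finset.card_le_card (add_subsequenceSums_subset (k := k) hAS)
    have hApos := hne.card_pos
    rw [Multiset.card_sub hAS] at hsums hcard'
    rw [Finset.card_val] at hsums hcard'
    omega

/-- Theorem 2.2: Let `p` be a prime, `1 ≤ k ≤ p - 2`, and `S` a sequence in `ZMod p` of
length `p + k` with no zero-sum subsequence of length `p`. Then some element of `ZMod p`
occurs at least `k + 1` times in `S`, i.e. `h(S) ≥ k + 1`. -/
theorem stmt_2 (p k : ℕ) (hp : p.Prime) (hk1 : 1 ≤ k) (hk : k ≤ p - 2)
    (S : Multiset (ZMod p)) (hcard : Multiset.card S = p + k)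
    (hzs : ¬ ∃ T ≤ S, Multiset.card T = p ∧ T.sum = 0) :
    ∃ g : ZMod p, k + 1 ≤ S.count g := by
  by_contra! hcount
  have : Fact p.Prime := ⟨hp⟩
  have hle := min_le_card_subsequenceSums hp k S
    (fun g => Nat.lt_succ_iff.mp (hcount g)) (by omega)
  have huniv : subsequenceSums k S = Finset.univ := by
    apply Finset.eq_univ_of_card
    apply le_antisymm (Finset.card_le_univ _)
    rw [ZMod.card]
    omega
  obtain ⟨T, hT, hTcard, hTsum⟩ :=
    mem_subsequenceSums.mp (huniv ▸ Finset.mem_univ S.sum : S.sum ∈ subsequenceSums k S)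
  refine hzs ⟨S - T, Multiset.sub_le_self S T, by rw [Multiset.card_sub hT]; omega, ?_⟩
  have hsum := congrArg Multiset.sum (tsub_add_cancel_of_le hT)
  rw [Multiset.sum_add, hTsum] at hsum
  exact add_eq_right.mp hsum
end

section
/- Let p be an odd prime and let k be an integer with 1 ≤ k ≤ ⌊(p+1)/3⌋. Let S = (1^{p−2k+1}, x_1, x_2, …, x_{k−1}) be a sequence in Z_p∖{0} of length p − k (the element 1 occurring p−2k+1 times) such that the sum of the least positive representatives satisfies x̄_1 + … + x̄_{k−1} ≤ 2k − 2. Then for every x ∈ Z_p satisfying p − 2k + 1 ≤ x̄ ≤ p − 2k + 1 + (x̄_1 + … + x̄_{k−1}), there exists a subsequence T of S with |T| ≥ p − 2k + 1 and σ(T) = x. -/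
/-- The least positive representative of `z : ZMod n`, lying in `{1, …, n}` (so `0̄ = n`). -/
def barRep (n : ℕ) (z : ZMod n) : ℕ := if z = 0 then n else z.val

open Finset in
/-- If positive integers `f i`, `i ∈ s`, have average at most `2`, then every `u ≤ ∑ i ∈ s, f i`
lies between `∑ i ∈ A, f i - #A` and `∑ i ∈ A, f i` for some `A ⊆ s`. -/
theorem exists_subset_le_sum_le_add_card {ι : Type*} [DecidableEq ι] (f : ι → ℕ) (s : Finset ι)
    (hpos : ∀ i ∈ s, 1 ≤ f i) (hsum : ∑ i ∈ s, f i ≤ 2 * #s) (u : ℕ) (hu : u ≤ ∑ i ∈ s, f i) :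
    ∃ A ⊆ s, u ≤ ∑ i ∈ A, f i ∧ ∑ i ∈ A, f i ≤ u + #A := by
  induction s using Finset.induction_on_max_value f with
  | empty => exact ⟨∅, by simp_all⟩
  | insert a s ha hmax ih =>
    have hs : ∀ i ∈ s, 1 ≤ f i := fun i hi => hpos i (mem_insert_of_mem hi)
    have hlow : #s ≤ ∑ i ∈ s, f i := by simpa using s.card_nsmul_le_sum f 1 hs
    have hupp : ∑ i ∈ s, f i ≤ #s * f a := by simpa using s.sum_le_card_nsmul f (f a) hmax
    rw [sum_insert ha] at hsum hu
    rw [card_insert_of_notMem ha] at hsum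
    rcases le_or_gt u (∑ i ∈ s, f i) with h | h
    · have hs2 : ∑ i ∈ s, f i ≤ 2 * #s := by
        rcases le_or_gt (f a) 1 with h1 | h1
        · nlinarith
        · omega
      obtain ⟨A, hA, hA'⟩ := ih hs hs2 h
      exact ⟨A, hA.trans (subset_insert a s), hA'⟩
    · refine ⟨insert a s, Subset.rfl, ?_⟩
      rw [sum_insert ha, card_insert_of_notMem ha]
      omega

theorem natCast_barRep (n : ℕ) [NeZero n] (z : ZMod n) : (barRep n z : ZMod n) = z := by
  unfold barRep
  split_ifs with h <;> simp [h]

theorem one_le_barRep (n : ℕ) [NeZero n] (z : ZMod n) : 1 ≤ barRep n z := by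
  unfold barRep
  split_ifs with h
  · exact NeZero.one_le
  · exact Nat.one_le_iff_ne_zero.2 ((ZMod.val_ne_zero z).2 h)

/-- Lemma 2.4: Let `p` be an odd prime, `1 ≤ k ≤ ⌊(p+1)/3⌋`, and
`S = (1^{p-2k+1}, x_1, …, x_{k-1})` a sequence in `ZMod p \ {0}` of length `p - k` with
`x̄_1 + ⋯ + x̄_{k-1} ≤ 2k - 2`. Then for every `y ∈ ZMod p` with
`p - 2k + 1 ≤ ȳ ≤ p - 2k + 1 + (x̄_1 + ⋯ + x̄_{k-1})` there is a subsequence `T` of `S`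
with `|T| ≥ p - 2k + 1` and `σ(T) = y`. -/
theorem stmt_3 (p k : ℕ) (hp : p.Prime) (hodd : Odd p)
    (hk1 : 1 ≤ k) (hk : k ≤ (p + 1) / 3)
    (x : Fin (k - 1) → ZMod p) (hx0 : ∀ i, x i ≠ 0)
    (hbar : ∑ i, barRep p (x i) ≤ 2 * k - 2)
    (S : Multiset (ZMod p))
    (hS : S = Multiset.replicate (p - 2 * k + 1) (1 : ZMod p)
            + Multiset.map x Finset.univ.val)
    (y : ZMod p)
    (hy1 : p - 2 * k + 1 ≤ barRep p y)
    (hy2 : barRep p y ≤ p - 2 * k + 1 + ∑ i, barRep p (x i)) :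
    ∃ T ≤ S, p - 2 * k + 1 ≤ Multiset.card T ∧ T.sum = y := by
  have : NeZero p := ⟨hp.ne_zero⟩
  obtain ⟨A, -, hA1, hA2⟩ := exists_subset_le_sum_le_add_card (fun i => barRep p (x i))
    Finset.univ (fun i _ => one_le_barRep p (x i)) (by rw [Finset.card_fin]; omega)
    (barRep p y - (p - 2 * k + 1)) (by omega)
  have hAcard : A.card ≤ k - 1 := by simpa using A.card_le_univ
  have hle : ∑ i ∈ A, barRep p (x i) ≤ barRep p y := by omega
  refine ⟨Multiset.replicate (barRep p y - ∑ i ∈ A, barRep p (x i)) 1 + A.val.map x, ?_, ?_, ?_⟩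
  · rw [hS]
    exact add_le_add (Multiset.replicate_le_replicate 1 |>.2 (by omega))
      (Multiset.map_le_map (Finset.val_le_iff.2 A.subset_univ))
  · simp only [Multiset.card_add, Multiset.card_replicate, Multiset.card_map, Finset.card_val]
    omega
  · have hsum : (A.val.map x).sum = ∑ i ∈ A, x i := rfl
    simp [hsum, Nat.cast_sub hle, natCast_barRep]
end

section
/- Let p be a prime and let k be any positive integer. Let S' = (x_1, x_2, …, x_k) be a sequence in Z_p∖{0} of length k such that the least positive representatives satisfy x̄_1 + … + x̄_k ≤ 2k. Then for every x ∈ Z_p satisfying 1 ≤ x̄ ≤ x̄_1 + … + x̄_k, either x ∈ Σ(S') or x + 1 ∈ Σ(S'). -/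
/-- A multiset of positive integers whose sum is at most twice its cardinality has, for every
`m` up to its sum, a submultiset with sum `m` or `m + 1`. -/
theorem exists_le_sum_eq_or_sum_eq_succ (n : ℕ) :
    ∀ M : Multiset ℕ, M.card = n → (∀ a ∈ M, 1 ≤ a) → M.sum ≤ 2 * M.card →
      ∀ m ≤ M.sum, ∃ T ≤ M, T.sum = m ∨ T.sum = m + 1 := by
  induction n with
  | zero =>
    intro M hM _ _ m hm
    obtain rfl := Multiset.card_eq_zero.mp hM
    exact ⟨0, le_rfl, Or.inl (Nat.le_zero.mp hm).symm⟩
  | succ n ih =>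
    intro M hM hpos hsum m hm
    by_cases h : ∃ a ∈ M, 2 ≤ a
    · obtain ⟨a, haM, ha⟩ := h
      obtain ⟨R, rfl⟩ := Multiset.exists_cons_of_mem haM
      simp only [Multiset.card_cons, Multiset.sum_cons] at hM hsum hm
      have hRpos : ∀ b ∈ R, 1 ≤ b := fun b hb => hpos b (Multiset.mem_cons_of_mem hb)
      have hR : R.card ≤ R.sum := by
        simpa using Multiset.card_nsmul_le_sum hRpos
      have ihR := ih R (by omega) hRpos (by omega)
      by_cases h₁ : m ≤ R.sum
      · obtain ⟨T, hT, hs⟩ := ihR m h₁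
        exact ⟨T, hT.trans (Multiset.le_cons_self R a), hs⟩
      · by_cases h₂ : a ≤ m
        · obtain ⟨T, hT, hs⟩ := ihR (m - a) (by omega)
          refine ⟨a ::ₘ T, Multiset.cons_le_cons a hT, ?_⟩
          rw [Multiset.sum_cons]
          omega
        · refine ⟨{a}, by simp, ?_⟩
          rw [Multiset.sum_singleton]
          omega
    · push Not at h
      have hM1 : M = Multiset.replicate M.card 1 :=
        Multiset.eq_replicate_card.mpr fun b hb => by
          have := h b hb
          have := hpos b hb
          omega
      have hs : M.sum = M.card := by
        conv_lhs => rw [hM1]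
        simp
      refine ⟨Multiset.replicate m 1, ?_, Or.inl (by simp)⟩
      rw [hM1]
      exact Multiset.replicate_mono 1 (hs ▸ hm)

/-- The claim in Lemma 2.4: let `p` be a prime, `k ≥ 1`, and `S' = (x_1, …, x_k)` a sequence
in `ZMod p \ {0}` with `x̄_1 + ⋯ + x̄_k ≤ 2k`. Then for every `y ∈ ZMod p` with
`1 ≤ ȳ ≤ x̄_1 + ⋯ + x̄_k`, either `y ∈ Σ(S')` or `y + 1 ∈ Σ(S')`. -/
theorem stmt_4 (p k : ℕ) (hp : p.Prime) (hk : 1 ≤ k)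
    (x : Fin k → ZMod p) (hx0 : ∀ i, x i ≠ 0)
    (hbar : ∑ i, barRep p (x i) ≤ 2 * k)
    (y : ZMod p) (hy1 : 1 ≤ barRep p y) (hy2 : barRep p y ≤ ∑ i, barRep p (x i)) :
    (∃ T ≤ Multiset.map x Finset.univ.val, T ≠ 0 ∧ T.sum = y) ∨
    (∃ T ≤ Multiset.map x Finset.univ.val, T ≠ 0 ∧ T.sum = y + 1) := by
  have : NeZero p := ⟨hp.ne_zero⟩
  set M : Multiset ℕ := Multiset.map (fun i => barRep p (x i)) Finset.univ.val with hM
  have hMsum : M.sum = ∑ i, barRep p (x i) := rfl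
  have hMcard : M.card = k := by simp [hM]
  have hMpos : ∀ a ∈ M, 1 ≤ a := by
    intro a ha
    obtain ⟨i, -, rfl⟩ := Multiset.mem_map.mp ha
    simp [barRep, hx0 i, Nat.one_le_iff_ne_zero]
  have hMmap : M.map (Nat.cast : ℕ → ZMod p) = Multiset.map x Finset.univ.val := by
    simp [hM, Function.comp_def, natCast_barRep]
  obtain ⟨T, hT, hs⟩ := exists_le_sum_eq_or_sum_eq_succ k M hMcard hMpos
    (by rw [hMsum, hMcard]; exact hbar) (barRep p y) (by rw [hMsum]; exact hy2)
  have hle : T.map (Nat.cast : ℕ → ZMod p) ≤ Multiset.map x Finset.univ.val :=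
    hMmap ▸ Multiset.map_le_map hT
  have hne : T.map (Nat.cast : ℕ → ZMod p) ≠ 0 := by
    rw [Ne, Multiset.map_eq_zero]
    rintro rfl
    rw [Multiset.sum_zero] at hs
    omega
  have hcast : (T.map (Nat.cast : ℕ → ZMod p)).sum = (T.sum : ZMod p) :=
    (Nat.cast_multiset_sum T).symm
  rcases hs with hs | hs
  · exact Or.inl ⟨_, hle, hne, by rw [hcast, hs, natCast_barRep]⟩
  · exact Or.inr ⟨_, hle, hne, by rw [hcast, hs, Nat.cast_succ, natCast_barRep]⟩
end

section
/- Let n be a positive integer. If S is a sequence in Z_n of length 2n − 3 that has no zero-sum subsequence of length n, then there exist a, b ∈ Z_n such that b − a generates Z_n, a occurs exactly n − 1 times in S, and one of the following holds: (i) b occurs exactly n − 2 times in S; or (ii) b occurs exactly n − 3 times in S and the element 2b − a occurs exactly once in S. -/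
open scoped Pointwise

namespace ZeroSum

theorem pair_le_of_mem {α : Type*} {R : Multiset α} {y z : α} (hy : y ∈ R) (hz : z ∈ R)
    (hyz : y ≠ z) : ({y, z} : Multiset α) ≤ R := by
  refine (Multiset.le_iff_subset (by simp [hyz])).2 fun a ha => ?_
  rcases (by simpa using ha : a = y ∨ a = z) with rfl | rfl <;> assumption

theorem four_le_card {α : Type*} [DecidableEq α] {F : Finset α} {a b c d : α} (ha : a ∈ F)
    (hb : b ∈ F) (hc : c ∈ F) (hd : d ∈ F) (hab : a ≠ b) (hac : a ≠ c) (had : a ≠ d)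
    (hbc : b ≠ c) (hbd : b ≠ d) (hcd : c ≠ d) : 4 ≤ F.card := by
  have h4 : ({a, b, c, d} : Finset α).card = 4 := by
    simp [hab, hac, had, hbc, hbd, hcd]
  rw [← h4]
  refine Finset.card_le_card ?_
  simp [Finset.insert_subset_iff, ha, hb, hc, hd]

variable {G : Type*} [AddCommGroup G]

/-- `R` has no nonempty zero-sum subsequence of length at most `h`. -/
def ShortZeroSumFree (h : ℕ) (R : Multiset G) : Prop :=
  ∀ V ≤ R, Multiset.card V ≤ h → V.sum = 0 → V = 0

theorem ShortZeroSumFree.mono {h k : ℕ} {R Q : Multiset G} (hR : ShortZeroSumFree h R)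
    (hQ : Q ≤ R) (hk : k ≤ h) : ShortZeroSumFree k Q :=
  fun V hV hc hs => hR V (hV.trans hQ) (hc.trans hk) hs

variable [DecidableEq G]

/-- Moser–Scherk: if `0 ∈ A ∩ B` and `0` is represented only trivially in `A + B`, then
`|A + B| ≥ |A| + |B| - 1`. -/
theorem card_add_card_le_card_add (A B : Finset G) (hA : 0 ∈ A) (hB : 0 ∈ B)
    (h : ∀ a ∈ A, ∀ b ∈ B, a + b = 0 → b = 0) :
    A.card + B.card ≤ (A + B).card + 1 := by
  induction hk : B.card using Nat.strong_induction_on generalizing A B with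
  | _ k ih =>
  subst hk
  by_cases hex : ∃ a ∈ A, ∃ b ∈ B, a + b ∉ A
  · obtain ⟨a, ha, b, hb, hab⟩ := hex
    set D := B.filter (fun b => a + b ∉ A) with hD
    have hbD : b ∈ D := by simp [hD, hb, hab]
    have hDB : D ⊆ B := Finset.filter_subset _ _
    have hDpos : 0 < D.card := Finset.card_pos.2 ⟨b, hbD⟩
    have hDcard : (B \ D).card + D.card = B.card := Finset.card_sdiff_add_card_eq_card hDB
    have hdisj : Disjoint A (D.image (a + ·)) := by
      rw [Finset.disjoint_right]
      intro x hx
      obtain ⟨d, hd, rfl⟩ := Finset.mem_image.1 hx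
      exact (Finset.mem_filter.1 hd).2
    have hcard : (A ∪ D.image (a + ·)).card = A.card + D.card := by
      rw [Finset.card_union_of_disjoint hdisj,
        Finset.card_image_of_injective _ (add_right_injective a)]
    have hmem : ∀ c ∈ B \ D, c ∈ B ∧ a + c ∈ A := by
      intro c hc
      have := Finset.mem_sdiff.1 hc
      refine ⟨this.1, ?_⟩
      by_contra hcon
      exact this.2 (Finset.mem_filter.2 ⟨this.1, hcon⟩)
    have key := ih (B \ D).card (by omega) (A ∪ D.image (a + ·)) (B \ D)
      (Finset.mem_union_left _ hA)
      (Finset.mem_sdiff.2 ⟨hB, fun h0 => (Finset.mem_filter.1 h0).2 (by simpa using ha)⟩)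
      (by
        intro x hx c hc hxc
        obtain ⟨hcB, hcA⟩ := hmem c hc
        rcases Finset.mem_union.1 hx with hx | hx
        · exact h x hx c hcB hxc
        · obtain ⟨d, hd, rfl⟩ := Finset.mem_image.1 hx
          have hd0 := h (a + c) hcA d (hDB hd) (by rw [← hxc]; abel)
          exact absurd (by simpa [hd0] using ha) (Finset.mem_filter.1 hd).2)
      rfl
    have hsub : (A ∪ D.image (a + ·)) + (B \ D) ⊆ A + B := by
      intro s hs
      obtain ⟨x, hx, c, hc, rfl⟩ := Finset.mem_add.1 hs
      obtain ⟨hcB, hcA⟩ := hmem c hc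
      rcases Finset.mem_union.1 hx with hx | hx
      · exact Finset.add_mem_add hx hcB
      · obtain ⟨d, hd, rfl⟩ := Finset.mem_image.1 hx
        exact Finset.mem_add.2 ⟨a + c, hcA, d, hDB hd, by abel⟩
    have := Finset.card_le_card hsub
    omega
  · push Not at hex
    have hB0 : B = {0} := by
      refine Finset.eq_singleton_iff_unique_mem.2 ⟨hB, fun b hb => ?_⟩
      have himg : A.image (· + b) = A := by
        refine Finset.eq_of_subset_of_card_le ?_ ?_
        · intro x hx
          obtain ⟨a, ha, rfl⟩ := Finset.mem_image.1 hx
          exact hex a ha b hb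
        · rw [Finset.card_image_of_injective _ (add_left_injective b)]
      obtain ⟨a, ha, hab⟩ := Finset.mem_image.1 (himg ▸ hA)
      exact h a ha b hb hab
    simp [hB0]

/-- The sums of the subsequences of `R` of length at most `h`. -/
def shortSums (h : ℕ) (R : Multiset G) : Finset G :=
  ((R.powerset.filter (fun V => Multiset.card V ≤ h)).map Multiset.sum).toFinset

theorem mem_shortSums {h : ℕ} {R : Multiset G} {g : G} :
    g ∈ shortSums h R ↔ ∃ V ≤ R, Multiset.card V ≤ h ∧ V.sum = g := by
  simp [shortSums, and_assoc]

/-- Superadditivity of the number of subsequence sums. -/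
theorem ShortZeroSumFree.card_shortSums_add {h k : ℕ} {Q R : Multiset G}
    (hf : ShortZeroSumFree (h + k) (Q + R)) :
    (shortSums h Q).card + (shortSums k R).card ≤ (shortSums (h + k) (Q + R)).card + 1 := by
  have h1 := card_add_card_le_card_add (shortSums h Q) (shortSums k R)
    (mem_shortSums.2 ⟨0, by simp⟩) (mem_shortSums.2 ⟨0, by simp⟩) (by
      intro a ha b hb hab
      obtain ⟨V, hV, hVc, rfl⟩ := mem_shortSums.1 ha
      obtain ⟨U, hU, hUc, rfl⟩ := mem_shortSums.1 hb
      have := hf (V + U) (add_le_add hV hU) (by simp; omega) (by simpa using hab)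
      have hU0 : U = 0 := by
        have := congrArg Multiset.card this
        simp only [Multiset.card_add, Multiset.card_zero] at this
        exact Multiset.card_eq_zero.1 (by omega)
      simp [hU0])
  have h2 : shortSums h Q + shortSums k R ⊆ shortSums (h + k) (Q + R) := by
    intro s hs
    obtain ⟨a, ha, b, hb, rfl⟩ := Finset.mem_add.1 hs
    obtain ⟨V, hV, hVc, rfl⟩ := mem_shortSums.1 ha
    obtain ⟨U, hU, hUc, rfl⟩ := mem_shortSums.1 hb
    exact mem_shortSums.2 ⟨V + U, add_le_add hV hU, by simp; omega, by simp⟩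
  have := Finset.card_le_card h2
  omega

/-- A sequence with multiplicities at most `h` and no zero-sum subsequence of length at most `h`
has more than `|R|` sums of length at most `h`. -/
theorem ShortZeroSumFree.card_lt_card_shortSums {h : ℕ} {R : Multiset G}
    (hf : ShortZeroSumFree h R) (hc : ∀ g, R.count g ≤ h) :
    Multiset.card R < (shortSums h R).card := by
  induction h generalizing R with
  | zero =>
    have : R = 0 := Multiset.eq_zero_of_forall_notMem fun g hg => by
      have := Multiset.count_pos.2 hg
      have := hc g
      omega
    subst this
    exact Finset.card_pos.2 ⟨0, mem_shortSums.2 ⟨0, by simp⟩⟩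
  | succ h ih =>
    have hle : R.dedup ≤ R := Multiset.dedup_le R
    have hsplit : (R - R.dedup) + R.dedup = R := tsub_add_cancel_of_le hle
    have h1 := ih (R := R - R.dedup) (hf.mono (Multiset.sub_le_self _ _) (by omega)) (by
      intro g
      have := hc g
      rw [Multiset.count_sub, Multiset.count_dedup]
      split_ifs with hg
      · omega
      · rw [Multiset.count_eq_zero_of_notMem hg]; omega)
    have h0 : (0 : G) ∉ R := fun h0 => by
      have := hf {0} (Multiset.singleton_le.2 h0) (by simp) (by simp)
      simp at this
    have h2 : insert 0 R.toFinset ⊆ shortSums 1 R.dedup := by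
      intro g hg
      rcases Finset.mem_insert.1 hg with rfl | hg
      · exact mem_shortSums.2 ⟨0, by simp⟩
      · exact mem_shortSums.2 ⟨{g}, by simpa using hg, by simp, by simp⟩
    have h3 := Finset.card_le_card h2
    rw [Finset.card_insert_of_notMem (by simpa using h0), Multiset.card_toFinset] at h3
    have h4 := ShortZeroSumFree.card_shortSums_add (h := h) (k := 1) (Q := R - R.dedup)
      (R := R.dedup) (by rwa [hsplit])
    rw [hsplit] at h4
    have h5 := congrArg Multiset.card hsplit
    rw [Multiset.card_add] at h5
    omega

/-- Counting form: at most `|G| - |R| - 1` elements are not short sums. -/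
theorem ShortZeroSumFree.card_add_card_lt [Fintype G] {h : ℕ} {R : Multiset G}
    (hf : ShortZeroSumFree h R) (hc : ∀ g, R.count g ≤ h) (F : Finset G)
    (hF : ∀ g ∈ F, g ∉ shortSums h R) :
    Multiset.card R + F.card < Fintype.card G := by
  have h1 := hf.card_lt_card_shortSums hc
  have h2 : (F ∪ shortSums h R).card ≤ Fintype.card G := Finset.card_le_univ _
  rw [Finset.card_union_of_disjoint (Finset.disjoint_left.2 hF)] at h2
  omega


theorem exists_le_of_mem_shortSums_sub {k : ℕ} {R U U' : Multiset G} {g : G} (hU : U ≤ R)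
    (hU' : U' ≤ U) (hg : g ∈ shortSums k (R - U)) :
    ∃ V ≤ R, Multiset.card U' ≤ Multiset.card V ∧ Multiset.card V ≤ k + Multiset.card U' ∧
      V.sum = g + U'.sum ∧ (Multiset.card V = Multiset.card U' → g = 0) := by
  obtain ⟨V, hV, hVk, rfl⟩ := mem_shortSums.1 hg
  refine ⟨V + U', ?_, by simp, by simpa using hVk, by simp, fun h => ?_⟩
  · calc V + U' ≤ (R - U) + U := add_le_add hV hU'
      _ = R := tsub_add_cancel_of_le hU
  · have : V = 0 := by simpa using h
    simp [this]

/-- A sum of length `≤ k` outside `U` cannot be the negative of a nonempty subsum of `U`. -/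
theorem ShortZeroSumFree.neg_sum_notMem {h k : ℕ} {R U U' : Multiset G}
    (hf : ShortZeroSumFree h R) (hU : U ≤ R) (hU' : U' ≤ U) (hpos : 0 < Multiset.card U')
    (hk : k + Multiset.card U' ≤ h) : -U'.sum ∉ shortSums k (R - U) := by
  intro hg
  obtain ⟨V, hV, h1, h2, h3, -⟩ := exists_le_of_mem_shortSums_sub hU hU' hg
  have := hf V hV (h2.trans hk) (by simpa using h3)
  simp [this] at h1
  simp [h1] at hpos

theorem ShortZeroSumFree.eq_of_mem [Fintype G] {h : ℕ} {R : Multiset G}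
    (hf : ShortZeroSumFree (h + 2) R) (hc : ∀ g, R.count g ≤ h)
    (hcard : Multiset.card R + 1 = Fintype.card G) {y z : G} (hy : y ∈ R) (hz : z ∈ R) :
    y = z := by
  by_contra hyz
  have hU := pair_le_of_mem hy hz hyz
  have hne : ∀ a ∈ R, a ≠ 0 := by
    rintro a ha rfl
    simpa using hf {0} (by simpa using ha) (by simp) (by simp)
  have hlt := (hf.mono (Multiset.sub_le_self R {y, z}) (Nat.le_add_right h 2)).card_add_card_lt
    (fun g => (Multiset.count_le_of_le g (Multiset.sub_le_self _ _)).trans (hc g))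
    {-y, -z, -(y + z)} (by
      intro g hg
      simp only [Finset.mem_insert, Finset.mem_singleton] at hg
      rcases hg with rfl | rfl | rfl
      · simpa using hf.neg_sum_notMem (k := h) (U' := {y}) hU (by simp) (by simp) (by simp)
      · simpa using hf.neg_sum_notMem (k := h) (U' := {z}) hU (by simp) (by simp) (by simp)
      · simpa using hf.neg_sum_notMem (k := h) (U' := {y, z}) hU le_rfl (by simp) (by simp))
  rw [Finset.card_eq_three.2 ⟨_, _, _, by simpa using hyz, by simpa using hne z hz,
    by simpa using hne y hy, rfl⟩, Multiset.card_sub hU] at hlt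
  have := Multiset.card_le_card hU
  simp at this hlt
  omega

theorem sub_sum_notMem {h k : ℕ} {R U U' : Multiset G} {x : G}
    (hx : ∀ V ≤ R, V.sum = x → 2 ≤ Multiset.card V → h < Multiset.card V)
    (hU : U ≤ R) (hU' : U' ≤ U) (hpos : 0 < Multiset.card U') (hne : U'.sum ≠ x)
    (hk : k + Multiset.card U' ≤ h) : x - U'.sum ∉ shortSums k (R - U) := by
  intro hg
  obtain ⟨V, hV, h1, h2, h3, h4⟩ := exists_le_of_mem_shortSums_sub hU hU' hg
  have hV2 : 2 ≤ Multiset.card V := by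
    by_contra hcon
    exact hne (sub_eq_zero.1 (h4 (by omega))).symm
  have := hx V hV (by simpa using h3) hV2
  omega

/-- The impossible configuration with a remainder of length `|G| - 2`. -/
theorem ShortZeroSumFree.false_of_card_add_two [Fintype G] {h : ℕ} {R : Multiset G} {x : G}
    (hf : ShortZeroSumFree (h + 1) R) (hc : ∀ g, R.count g ≤ h)
    (hcard : Multiset.card R + 2 = Fintype.card G) (hh : h + 3 ≤ Fintype.card G) (hx0 : x ≠ 0)
    (hx : ∀ V ≤ R, V.sum = x → 2 ≤ Multiset.card V → h + 2 < Multiset.card V)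
    (hcx : R.count x < h) : False := by
  have hne : ∀ a ∈ R, a ≠ 0 := by
    rintro a ha rfl
    simpa using hf {0} (by simpa using ha) (by simp) (by simp)
  have hpair : ∀ y z, ({y, z} : Multiset G) ≤ R → y + z ≠ x := by
    intro y z hU hs
    have := hx _ hU (by simpa using hs) (by simp)
    simp at this
  -- two distinct values other than `x` differ by `x`
  have hdiff : ∀ y ∈ R, ∀ z ∈ R, y ≠ x → z ≠ x → y ≠ z → z = x + y := by
    intro y hy z hz hyx hzx hyz
    by_contra hcon
    have hU := pair_le_of_mem hy hz hyz
    have hlt := (hf.mono (Multiset.sub_le_self R {y, z}) (Nat.le_add_right h 1)).card_add_card_lt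
      (fun g => (Multiset.count_le_of_le g (Multiset.sub_le_self _ _)).trans (hc g))
      {-y, x - y, x - z, x - (y + z)} (by
        intro g hg
        simp only [Finset.mem_insert, Finset.mem_singleton] at hg
        rcases hg with rfl | rfl | rfl | rfl
        · simpa using hf.neg_sum_notMem (k := h) (U' := {y}) hU (by simp) (by simp) (by simp)
        · simpa using sub_sum_notMem hx (k := h) (U' := {y}) hU (by simp) (by simp)
            (by simpa using hyx) (by simp)
        · simpa using sub_sum_notMem hx (k := h) (U' := {z}) hU (by simp) (by simp)
            (by simpa using hzx) (by simp)
        · simpa using sub_sum_notMem hx (k := h) (U' := {y, z}) hU le_rfl (by simp)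
            (by simpa using hpair y z hU) (by simp))
    have h4 : ({-y, x - y, x - z, x - (y + z)} : Finset G).card = 4 := by
      rw [Finset.card_insert_of_notMem, Finset.card_eq_three.2
        ⟨_, _, _, by simpa using hyz, by simpa using hne z hz, by simpa using hne y hy, rfl⟩]
      simp only [Finset.mem_insert, Finset.mem_singleton, not_or]
      refine ⟨fun e => hx0 ?_, fun e => hcon ?_, fun e => hzx ?_⟩
      all_goals grind
    rw [h4, Multiset.card_sub hU] at hlt
    have := Multiset.card_le_card hU
    simp at this hlt
    omega
  obtain ⟨k, rfl⟩ : ∃ k, h = k + 1 := ⟨h - 1, by omega⟩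
  -- removing a pair that lowers all multiplicities
  have hrem : ∀ y z, ({y, z} : Multiset G) ≤ R → y ≠ x → z ≠ x → (y = z → x ≠ -y) →
      (∀ g, (R - {y, z}).count g ≤ k) → False := by
    intro y z hU hyx hzx hy' hcnt
    have hy : y ∈ R := Multiset.mem_of_le hU (by simp)
    have hz : z ∈ R := Multiset.mem_of_le hU (by simp)
    have havoid : ∀ g ∈ ({-y, -z, -(y + z), x - y, x - z, x - (y + z)} : Finset G),
        g ∉ shortSums k (R - {y, z}) := by
      intro g hg
      simp only [Finset.mem_insert, Finset.mem_singleton] at hg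
      rcases hg with rfl | rfl | rfl | rfl | rfl | rfl
      · simpa using hf.neg_sum_notMem (k := k) (U' := {y}) hU (by simp) (by simp) (by simp)
      · simpa using hf.neg_sum_notMem (k := k) (U' := {z}) hU (by simp) (by simp) (by simp)
      · simpa using hf.neg_sum_notMem (k := k) (U' := {y, z}) hU le_rfl (by simp) (by simp)
      · simpa using sub_sum_notMem hx (k := k) (U' := {y}) hU (by simp) (by simp)
          (by simpa using hyx) (by simp)
      · simpa using sub_sum_notMem hx (k := k) (U' := {z}) hU (by simp) (by simp)
          (by simpa using hzx) (by simp)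
      · simpa using sub_sum_notMem hx (k := k) (U' := {y, z}) hU le_rfl (by simp)
          (by simpa using hpair y z hU) (by simp)
    have hlt := (hf.mono (k := k) (Multiset.sub_le_self R {y, z}) (by omega)).card_add_card_lt
      hcnt _ havoid
    have h4 : 4 ≤ ({-y, -z, -(y + z), x - y, x - z, x - (y + z)} : Finset G).card := by
      have hy0 := hne y hy
      have hz0 := hne z hz
      by_cases hyz : y = z
      · subst hyz
        have hxy := hy' rfl
        exact four_le_card (a := -y) (b := -(y + y)) (c := x - y) (d := x - (y + y))
          (by simp) (by simp) (by simp) (by simp)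
          (by grind) (by grind) (by grind) (by grind) (by grind) (by grind)
      · have hlast : ∃ a ∈ ({-y, -z, -(y + z), x - y, x - z, x - (y + z)} : Finset G),
            a ≠ x - y ∧ a ≠ x - z ∧ a ≠ x - (y + z) := by
          by_cases h1 : x = -z
          · exact ⟨-z, by simp, by grind, by grind, by grind⟩
          by_cases h2 : x = -y
          · exact ⟨-y, by simp, by grind, by grind, by grind⟩
          · exact ⟨-(y + z), by simp, by grind, by grind, by grind⟩
        obtain ⟨a, haF, ha1, ha2, ha3⟩ := hlast
        exact four_le_card haF (b := x - y) (c := x - z) (d := x - (y + z))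
          (by simp) (by simp) (by simp) ha1 ha2 ha3 (by grind) (by grind) (by grind)
    rw [Multiset.card_sub hU] at hlt
    have := Multiset.card_le_card hU
    simp only [Multiset.insert_eq_cons, Multiset.card_cons, Multiset.card_singleton] at this hlt
    omega
  have hexists : ∃ y ∈ R, y ≠ x := by
    by_contra! hall
    have := Multiset.eq_replicate_card.2 hall
    have := congrArg (Multiset.count x) this
    rw [Multiset.count_replicate_self] at this
    omega
  obtain ⟨y, hy, hyx⟩ := hexists
  by_cases hz : ∃ z ∈ R, z ≠ x ∧ y ≠ z
  · obtain ⟨z, hz, hzx, hyz⟩ := hz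
    refine hrem y z (pair_le_of_mem hy hz hyz) hyx hzx (fun e => absurd e hyz) fun g => ?_
    rw [Multiset.count_sub]
    have hg := hc g
    by_cases hgx : g = x
    · subst hgx; omega
    by_cases hgR : g ∈ R
    · have hgyz : g = y ∨ g = z := by
        by_contra! hcon
        have h1 := hdiff y hy z hz hyx hzx hyz
        have h2 := hdiff y hy g hgR hyx hgx hcon.1.symm
        exact hcon.2 (h2.trans h1.symm)
      have : 0 < ({y, z} : Multiset G).count g := Multiset.count_pos.2 (by simpa using hgyz)
      omega
    · rw [Multiset.count_eq_zero_of_notMem hgR]; omega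
  · push Not at hz
    have hsum : R.count x + R.count y = Multiset.card R := by
      have : R = Multiset.replicate (R.count x) x + Multiset.replicate (R.count y) y := by
        ext g
        rw [Multiset.count_add, Multiset.count_replicate, Multiset.count_replicate]
        by_cases h1 : x = g
        · subst h1; simp [hyx]
        · by_cases h2 : y = g
          · subst h2; simp [h1]
          · rw [if_neg h1, if_neg h2]
            exact Multiset.count_eq_zero_of_notMem fun hg => h2 (hz g hg (Ne.symm h1))
      simpa using (congrArg Multiset.card this).symm
    have hcy := hc y
    have hU : ({y, y} : Multiset G) ≤ R :=
      Multiset.le_count_iff_replicate_le (n := 2).1 (by omega)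
    refine hrem y y hU hyx hyx (fun _ e => ?_) fun g => ?_
    · have hxR : x ∈ R := Multiset.count_pos.1 (by omega)
      have := hf {x, y} (pair_le_of_mem hxR hy hyx.symm) (by simp) (by simp [e])
      simp at this
    · rw [Multiset.count_sub]
      by_cases hgx : g = x
      · subst hgx; omega
      by_cases hgy : g = y
      · subst hgy; simp; omega
      · rw [Multiset.count_eq_zero_of_notMem fun hg => hgy (hz g hg hgx).symm]; omega


/-- A most frequent element, normalised to be `0`, occurs at least `|G| - 1` times in a sequence
of length `2|G| - 3` without zero-sum subsequences of length `|G|`. -/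
theorem card_le_count_zero_add_one [Fintype G] {S : Multiset G}
    (hcard : Multiset.card S + 3 = 2 * Fintype.card G)
    (hmax : ∀ g, S.count g ≤ S.count 0)
    (hzs : ∀ U ≤ S, Multiset.card U = Fintype.card G → U.sum ≠ 0) :
    Fintype.card G ≤ S.count 0 + 1 := by
  by_contra! hlt
  set n := Fintype.card G with hn
  set h := S.count 0 with hh
  set T := S.filter (· ≠ 0) with hT
  have hsplit : Multiset.replicate h 0 + T = S := by
    rw [hT, hh, ← Multiset.filter_eq' S 0]
    exact Multiset.filter_add_not _ _
  have hTcard : h + Multiset.card T = Multiset.card S := by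
    rw [← hsplit]; simp
  have hT0 : ∀ a ∈ T, a ≠ 0 := fun a ha => (Multiset.mem_filter.1 ha).2
  have hTc : ∀ g, T.count g ≤ h := fun g =>
    (Multiset.count_le_of_le g (Multiset.filter_le _ _)).trans (hmax g)
  have hpos : 0 < h := by
    obtain ⟨g, hg⟩ := Multiset.card_pos_iff_exists_mem.1 (by omega : 0 < Multiset.card S)
    exact (Multiset.count_pos.2 hg).trans_le (hmax g)
  have hwin : ∀ W ≤ T, W.sum = 0 → Multiset.card W ≤ n → Multiset.card W + h < n := by
    intro W hW hs hc
    by_contra! hcon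
    refine hzs (Multiset.replicate (n - Multiset.card W) 0 + W) ?_ ?_ (by simp [hs])
    · rw [← hsplit]
      exact add_le_add ((Multiset.replicate_le_replicate 0).2 (by omega)) hW
    · simp; omega
  obtain ⟨W, ⟨hW, hWs, hWn⟩, hWmax⟩ : ∃ W, (W ≤ T ∧ W.sum = 0 ∧ Multiset.card W ≤ n) ∧
      ∀ V, V ≤ T ∧ V.sum = 0 ∧ Multiset.card V ≤ n → Multiset.card V ≤ Multiset.card W := by
    have hfin : Set.Finite {V : Multiset G | V ≤ T ∧ V.sum = 0 ∧ Multiset.card V ≤ n} :=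
      (Set.finite_Iic T).subset fun V hV => hV.1
    exact Set.exists_max_image _ Multiset.card hfin
      ⟨0, Multiset.zero_le T, Multiset.sum_zero, Nat.zero_le _⟩
  have hWh := hwin W hW hWs hWn
  set R := T - W with hR
  have hRW : R + W = T := tsub_add_cancel_of_le hW
  have hRcard : Multiset.card R + Multiset.card W = Multiset.card T := by
    rw [← hRW, Multiset.card_add]
  have hRT : R ≤ T := Multiset.sub_le_self _ _
  have hRc : ∀ g, R.count g ≤ h := fun g => (Multiset.count_le_of_le g hRT).trans (hTc g)
  have hRf : ShortZeroSumFree (n - Multiset.card W) R := by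
    intro V hV hVc hVs
    have := hWmax (V + W) ⟨hRW ▸ add_le_add_left hV W, by simp [hVs, hWs], by simp; omega⟩
    simpa using this
  have h1 := (hRf.mono le_rfl (by omega : h ≤ n - Multiset.card W)).card_add_card_lt hRc ∅ (by simp)
  simp only [Finset.card_empty, add_zero] at h1
  rcases (by omega : Multiset.card R + 1 = n ∨ Multiset.card R + 2 = n) with h2 | h2
  · obtain ⟨y, hy⟩ := Multiset.card_pos_iff_exists_mem.1 (by omega : 0 < Multiset.card R)
    have hrep := Multiset.eq_replicate_card.2 fun z hz =>
      ShortZeroSumFree.eq_of_mem (hRf.mono le_rfl (by omega)) hRc h2 hz hy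
    have h3 := hRc y
    rw [hrep, Multiset.count_replicate_self] at h3
    omega
  · obtain ⟨x, hx⟩ := Multiset.card_pos_iff_exists_mem.1 (by omega : 0 < Multiset.card W)
    have hx0 := hT0 x (Multiset.mem_of_le hW hx)
    have hW2 : Multiset.card W ≠ 1 := by
      intro h1
      obtain ⟨w, rfl⟩ := Multiset.card_eq_one.1 h1
      rw [Multiset.mem_singleton] at hx
      subst hx
      exact hx0 (by simpa using hWs)
    refine ShortZeroSumFree.false_of_card_add_two (h := h) (x := x)
      (hRf.mono le_rfl (by omega)) hRc h2 (by omega) hx0 ?_ ?_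
    · intro V hV hVs hV2
      by_contra! hcon
      have hcx := Multiset.card_erase_add_one hx
      have hsx : x + (W.erase x).sum = 0 := by rw [Multiset.sum_erase hx, hWs]
      have := hwin (V + W.erase x) (hRW ▸ add_le_add hV (Multiset.erase_le x W))
        (by simp [hVs, hsx]) (by simp; omega)
      simp at this
      omega
    · have := hTc x
      rw [← hRW, Multiset.count_add] at this
      have := Multiset.count_pos.2 hx
      omega

theorem four_le_card_shortSums_pair {y z : G} (hf : ShortZeroSumFree 2 ({y, z} : Multiset G))
    (hyz : y ≠ z) : 4 ≤ (shortSums 2 ({y, z} : Multiset G)).card := by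
  have hy : y ≠ 0 := by
    rintro rfl
    simpa using hf {0} (by simp) (by simp) (by simp)
  have hz : z ≠ 0 := by
    rintro rfl
    simpa using hf {0} (by simp) (by simp) (by simp)
  have hs : y + z ≠ 0 := fun hs => by
    simpa using hf {y, z} le_rfl (by simp) (by simpa using hs)
  exact four_le_card (a := 0) (b := y) (c := z) (d := y + z)
    (mem_shortSums.2 ⟨0, by simp⟩) (mem_shortSums.2 ⟨{y}, by simp⟩)
    (mem_shortSums.2 ⟨{z}, by simp⟩) (mem_shortSums.2 ⟨{y, z}, by simp⟩)
    hy.symm hz.symm hs.symm hyz (by simpa using hz) (by simpa using hy)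

/-- In a zero-sum free sequence of length `|G| - 2`, what remains after removing two distinct terms
is constant. -/
theorem ShortZeroSumFree.eq_of_mem_sub_pair [Fintype G] {T : Multiset G}
    (hf : ∀ k, ShortZeroSumFree k T) (hcard : Multiset.card T + 2 = Fintype.card G)
    {y z u v : G} (hU : {y, z} ≤ T) (hyz : y ≠ z) (hu : u ∈ T - {y, z}) (hv : v ∈ T - {y, z}) :
    u = v := by
  by_contra huv
  have hU' := pair_le_of_mem hu hv huv
  set Q := T - {y, z} - {u, v} with hQ
  have h1 : Q + {u, v} + {y, z} = T := by
    rw [hQ, tsub_add_cancel_of_le hU', tsub_add_cancel_of_le hU]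
  have hle1 : Q + {u, v} ≤ T := h1 ▸ Multiset.le_add_right _ _
  have hleQ : Q ≤ T := (Multiset.le_add_right _ _).trans hle1
  set m := Multiset.card T
  have hcount : ∀ g, Q.count g ≤ m := fun g =>
    (Multiset.count_le_card g Q).trans (Multiset.card_le_card hleQ)
  have h2 := ((hf m).mono hleQ le_rfl).card_lt_card_shortSums hcount
  have h3 := ((hf (m + 2)).mono hle1 le_rfl).card_shortSums_add (h := m)
  have h4 := ShortZeroSumFree.card_shortSums_add (h := m + 2) (k := 2) (Q := Q + {u, v})
    (R := {y, z}) (h1 ▸ hf _)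
  have h5 := four_le_card_shortSums_pair ((hf 2).mono hU le_rfl) hyz
  have h6 := four_le_card_shortSums_pair
    ((hf 2).mono (hU'.trans (Multiset.sub_le_self _ _)) le_rfl) huv
  have h7 : (shortSums (m + 2 + 2) (Q + {u, v} + {y, z})).card ≤ Fintype.card G :=
    Finset.card_le_univ _
  have h8 := congrArg Multiset.card h1
  simp only [Multiset.card_add, Multiset.insert_eq_cons, Multiset.card_cons,
    Multiset.card_singleton] at h8 h2 h3 h4 h5 h6 h7
  omega

section ZMod

variable {n : ℕ} [NeZero n]

theorem zmultiples_eq_top_of_nsmul_ne_zero {m : ℕ} {g : ZMod n} (hm : n < 2 * (m + 1))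
    (hg : ∀ k, 0 < k → k ≤ m → k • g ≠ 0) : AddSubgroup.zmultiples g = ⊤ := by
  have hlt : m < addOrderOf g := by
    by_contra! hcon
    exact hg _ (addOrderOf_pos g) hcon (addOrderOf_nsmul_eq_zero g)
  have hdvd : addOrderOf g ∣ n := by
    simpa using addOrderOf_dvd_card (x := g)
  obtain ⟨c, hc⟩ := hdvd
  have hc1 : c = 1 := by
    have : 0 < n := NeZero.pos n
    rcases c with _ | _ | c
    · omega
    · rfl
    · nlinarith
  refine AddSubgroup.eq_top_of_card_eq _ ?_
  rw [Nat.card_zmultiples, Nat.card_zmod]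
  simpa [hc1] using hc.symm

theorem zmultiples_eq_top_of_count {T : Multiset (ZMod n)} {g : ZMod n}
    (hf : ∀ k, ShortZeroSumFree k T) (hg : n < 2 * (T.count g + 1)) :
    AddSubgroup.zmultiples g = ⊤ := by
  refine zmultiples_eq_top_of_nsmul_ne_zero hg fun k hk hkc hkg => ?_
  have := hf k (Multiset.replicate k g) (Multiset.le_count_iff_replicate_le.1 hkc) (by simp)
    (by simpa using hkg)
  have := congrArg Multiset.card this
  simp at this
  omega

theorem eq_two_mul_of_replicate {g z : ZMod n}
    (hf : ∀ k, ShortZeroSumFree k (z ::ₘ Multiset.replicate (n - 3) g)) (hz : z ≠ g)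
    (hg : AddSubgroup.zmultiples g = ⊤) : z = 2 * g := by
  have hmem : z ∈ AddSubgroup.zmultiples g := hg ▸ AddSubgroup.mem_top z
  rw [mem_zmultiples_iff_mem_range_addOrderOf] at hmem
  obtain ⟨k, hk, rfl⟩ := Finset.mem_image.1 hmem
  have hord : addOrderOf g = n := by
    rw [← Nat.card_zmultiples, hg]; simp
  rw [Finset.mem_range, hord] at hk
  have hk0 : k ≠ 0 := by
    rintro rfl
    simpa using hf 1 {0} (by simp) (by simp) (by simp)
  have hk1 : k ≠ 1 := by
    rintro rfl
    simp at hz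
  have hk3 : ¬ 3 ≤ k := by
    intro hk3
    have := hf _ ((k • g) ::ₘ Multiset.replicate (n - k) g)
      (Multiset.cons_le_cons _ ((Multiset.replicate_le_replicate g).2 (by omega))) le_rfl (by
        rw [Multiset.sum_cons, Multiset.sum_replicate, ← add_nsmul, Nat.add_sub_cancel' hk.le]
        simp)
    simp at this
  obtain rfl : k = 2 := by omega
  simp

theorem exists_generator_of_zeroSumFree {T : Multiset (ZMod n)}
    (hf : ∀ k, ShortZeroSumFree k T) (hcard : Multiset.card T + 2 = n) :
    ∃ b : ZMod n, AddSubgroup.zmultiples b = ⊤ ∧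
      (T.count b = n - 2 ∨ (T.count b = n - 3 ∧ T.count (2 * b) = 1)) := by
  have hne : ∀ a ∈ T, a ≠ 0 := by
    rintro a ha rfl
    simpa using hf 1 {0} (by simpa using ha) (by simp) (by simp)
  have hfinish : ∀ g z : ZMod n, 3 ≤ n → z ≠ g → T = z ::ₘ Multiset.replicate (n - 3) g →
      AddSubgroup.zmultiples g = ⊤ → ∃ b : ZMod n, AddSubgroup.zmultiples b = ⊤ ∧
        (T.count b = n - 2 ∨ (T.count b = n - 3 ∧ T.count (2 * b) = 1)) := by
    intro g z hn hz hT hg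
    have hz2 := eq_two_mul_of_replicate (hT ▸ hf) hz hg
    refine ⟨g, hg, Or.inr ⟨?_, ?_⟩⟩
    · rw [hT, Multiset.count_cons_of_ne hz.symm, Multiset.count_replicate_self]
    · rw [← hz2, hT, Multiset.count_cons_self, Multiset.count_eq_zero_of_notMem]
      exact fun h => hz (Multiset.eq_of_mem_replicate h)
  by_cases hconst : ∃ g, ∀ a ∈ T, a = g
  · obtain ⟨g, hg⟩ := hconst
    have hrep := Multiset.eq_replicate_card.2 hg
    by_cases hn : n = 2
    · subst hn
      obtain rfl := Multiset.card_eq_zero.1 (by omega : Multiset.card T = 0)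
      refine ⟨1, zmultiples_eq_top_of_nsmul_ne_zero (m := 1) (by norm_num) ?_, by simp⟩
      intro k h1 h2
      obtain rfl : k = 1 := by omega
      simp
    · have hcount : T.count g = n - 2 := by
        rw [hrep, Multiset.count_replicate_self]; omega
      exact ⟨g, zmultiples_eq_top_of_count hf (by omega), Or.inl hcount⟩
  · push Not at hconst
    obtain ⟨y, hy⟩ : ∃ y, y ∈ T := by
      obtain ⟨a, ha, -⟩ := hconst 0
      exact ⟨a, ha⟩
    obtain ⟨z, hz, hzy⟩ := hconst y
    have hU := pair_le_of_mem hy hz hzy.symm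
    have hcU := Multiset.card_le_card hU
    have hsub := Multiset.card_sub hU
    have hadd : T - {y, z} + {y, z} = T := tsub_add_cancel_of_le hU
    have hsum : ∀ a b, ({a, b} : Multiset (ZMod n)) ≤ T → a + b ≠ 0 := fun a b hab h0 => by
      simpa using hf 2 _ hab (by simp) (by simpa using h0)
    simp only [Multiset.insert_eq_cons, Multiset.card_cons, Multiset.card_singleton] at hsub hcU
    by_cases hn4 : n = 4
    · subst hn4
      have hT : T = {y, z} := (Multiset.eq_of_le_of_card_le hU (by simp; omega)).symm
      have hfour : ∀ y z : ZMod 4, y ≠ 0 → z ≠ 0 → z ≠ y → y + z ≠ 0 →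
          (y ≠ 0 ∧ 2 • y ≠ 0) ∨ (z ≠ 0 ∧ 2 • z ≠ 0) := by
        decide
      have htop : ∀ w : ZMod 4, w ≠ 0 ∧ 2 • w ≠ 0 → AddSubgroup.zmultiples w = ⊤ := by
        intro w hw
        refine zmultiples_eq_top_of_nsmul_ne_zero (m := 2) (by norm_num) fun k h1 h2 => ?_
        interval_cases k
        · simpa using hw.1
        · exact hw.2
      rcases hfour y z (hne y hy) (hne z hz) hzy (hsum y z hU) with h | h
      · exact hfinish y z (by norm_num) hzy (by rw [hT]; exact Multiset.pair_comm y z) (htop _ h)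
      · exact hfinish z y (by norm_num) hzy.symm hT (htop _ h)
    · obtain ⟨g, hg⟩ := Multiset.card_pos_iff_exists_mem.1
        (by simp only [Multiset.insert_eq_cons]; omega : 0 < Multiset.card (T - {y, z}))
      have hgT : g ∈ T := Multiset.mem_of_le (Multiset.sub_le_self _ _) hg
      have hrep : T - {y, z} = Multiset.replicate (n - 4) g := by
        rw [Multiset.eq_replicate]
        refine ⟨by simp only [Multiset.insert_eq_cons]; omega, fun a ha => ?_⟩
        exact ShortZeroSumFree.eq_of_mem_sub_pair hf (by simpa using hcard) hU hzy.symm ha hg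
      have hgen : ∀ z, z ≠ g → T = z ::ₘ Multiset.replicate (n - 3) g →
          ∃ b : ZMod n, AddSubgroup.zmultiples b = ⊤ ∧
            (T.count b = n - 2 ∨ (T.count b = n - 3 ∧ T.count (2 * b) = 1)) := by
        intro z hz hT
        refine hfinish g z (by omega) hz hT (zmultiples_eq_top_of_count hf ?_)
        have : T.count g = n - 3 := by
          rw [hT, Multiset.count_cons_of_ne hz.symm, Multiset.count_replicate_self]
        omega
      have hsucc : Multiset.replicate (n - 3) g = g ::ₘ Multiset.replicate (n - 4) g := by
        rw [← Multiset.replicate_succ]; congr 1; omega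
      rw [hrep] at hadd
      by_cases hgy : g = y
      · subst hgy
        refine hgen z hzy ?_
        rw [hsucc, ← hadd, add_comm]
        simp [Multiset.cons_swap]
      by_cases hgz : g = z
      · subst hgz
        refine hgen y (Ne.symm hgy) ?_
        rw [hsucc, ← hadd, add_comm]
        simp
      exfalso
      by_cases hn5 : n = 5
      · subst hn5
        have hfive : ∀ y z g : ZMod 5, y ≠ 0 → z ≠ 0 → g ≠ 0 → z ≠ y → g ≠ y → g ≠ z →
            y + z = 0 ∨ g + y = 0 ∨ g + z = 0 := by
          decide
        rcases hfive y z g (hne y hy) (hne z hz) (hne g hgT) hzy hgy hgz with h | h | h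
        · exact hsum y z hU h
        · exact hsum g y (pair_le_of_mem hgT hy hgy) h
        · exact hsum g z (pair_le_of_mem hgT hz hgz) h
      · have hrest : T - {y, g} = z ::ₘ Multiset.replicate (n - 5) g := by
          have : T = z ::ₘ Multiset.replicate (n - 5) g + {y, g} := by
            rw [← hadd, show n - 4 = n - 5 + 1 by omega, Multiset.replicate_succ]
            ext a
            simp only [Multiset.count_add, Multiset.insert_eq_cons, Multiset.count_cons,
              Multiset.count_singleton]
            omega
          rw [this, add_tsub_cancel_right]
        refine hgz (ShortZeroSumFree.eq_of_mem_sub_pair hf (by simpa using hcard)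
          (pair_le_of_mem hy hgT (Ne.symm hgy)) (Ne.symm hgy) ?_ ?_)
        · rw [hrest, show n - 5 = n - 6 + 1 by omega, Multiset.replicate_succ]
          simp
        · rw [hrest]
          exact Multiset.mem_cons_self z _

/-- The structure theorem when a most frequent term is `0`. -/
theorem exists_generator_of_count_le_count_zero (hn : 2 ≤ n) {S : Multiset (ZMod n)}
    (hcard : Multiset.card S = 2 * n - 3) (hmax : ∀ g, S.count g ≤ S.count 0)
    (hzs : ∀ U ≤ S, Multiset.card U = n → U.sum ≠ 0) :
    ∃ b : ZMod n, AddSubgroup.zmultiples b = ⊤ ∧ S.count 0 = n - 1 ∧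
      (S.count b = n - 2 ∨ (S.count b = n - 3 ∧ S.count (2 * b) = 1)) := by
  have h1 : n ≤ S.count 0 + 1 := by
    simpa using card_le_count_zero_add_one (S := S) (by rw [ZMod.card]; omega) hmax
      (by simpa using hzs)
  have h2 : S.count 0 < n := by
    by_contra! hcon
    exact hzs _ (Multiset.le_count_iff_replicate_le.1 hcon) (by simp) (by simp)
  have h0 : S.count 0 = n - 1 := by omega
  set T := S.filter (· ≠ 0) with hT
  have hsplit : Multiset.replicate (n - 1) 0 + T = S := by
    rw [hT, ← h0, ← Multiset.filter_eq' S 0]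
    exact Multiset.filter_add_not _ _
  have hTcard := congrArg Multiset.card hsplit
  rw [Multiset.card_add, Multiset.card_replicate] at hTcard
  have hf : ∀ k, ShortZeroSumFree k T := by
    intro k V hV _ hVs
    by_contra hV0
    have hVpos := Multiset.card_pos.2 hV0
    have hVT := Multiset.card_le_card hV
    refine hzs (Multiset.replicate (n - Multiset.card V) 0 + V) ?_ (by simp; omega) (by simp [hVs])
    rw [← hsplit]
    exact add_le_add ((Multiset.replicate_le_replicate 0).2 (by omega)) hV
  have hcount : ∀ a, a ≠ 0 → S.count a = T.count a := fun a ha =>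
    (Multiset.count_filter_of_pos (p := (· ≠ 0)) ha).symm
  obtain ⟨b, hb, hor⟩ := exists_generator_of_zeroSumFree hf (by omega)
  have hb0 : b ≠ 0 := by
    rintro rfl
    have := congrArg (fun H : AddSubgroup (ZMod n) => Nat.card H) hb
    simp at this
    omega
  refine ⟨b, hb, h0, ?_⟩
  rw [hcount b hb0]
  refine hor.imp_right fun ⟨h3, h4⟩ => ⟨h3, ?_⟩
  rw [hcount, h4]
  exact (Multiset.mem_filter.1 (Multiset.count_pos.1 (by omega : 0 < T.count (2 * b)))).2

end ZMod

end ZeroSum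

/-- Flores–Ordaz: if `S` is a sequence in `ZMod n` of length `2n - 3` with no zero-sum
subsequence of length `n`, then there are `a, b ∈ ZMod n` with `b - a` generating `ZMod n`,
`a` occurring exactly `n - 1` times in `S`, and either (i) `b` occurs exactly `n - 2` times,
or (ii) `b` occurs exactly `n - 3` times and `2b - a` occurs exactly once in `S`. -/
theorem stmt_11 (n : ℕ) (hn : 0 < n) (S : Multiset (ZMod n))
    (hcard : Multiset.card S = 2 * n - 3)
    (hzs : ¬ ∃ T ≤ S, Multiset.card T = n ∧ T.sum = 0) :
    ∃ a b : ZMod n, AddSubgroup.zmultiples (b - a) = ⊤ ∧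
      S.count a = n - 1 ∧
      (S.count b = n - 2 ∨ (S.count b = n - 3 ∧ S.count (2 * b - a) = 1)) := by
  have : NeZero n := ⟨hn.ne'⟩
  by_cases h1 : n = 1
  · subst h1
    obtain rfl := Multiset.card_eq_zero.1 hcard
    exact ⟨0, 0, Subsingleton.elim _ _, by simp, by simp⟩
  obtain ⟨c, hc⟩ := Finite.exists_max (fun g => S.count g)
  have hcnt : ∀ g, (S.map (· - c)).count g = S.count (g + c) := fun g => by
    simpa using Multiset.count_map_eq_count' (· - c) S (sub_left_injective) (g + c)
  obtain ⟨b, hb, h0, hor⟩ := ZeroSum.exists_generator_of_count_le_count_zero (by omega)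
    (S := S.map (· - c)) (by simpa using hcard) (fun g => by simpa [hcnt] using hc (g + c)) (by
      intro U hU hUn hUs
      refine hzs ⟨U.map (· + c), ?_, by simpa using hUn, ?_⟩
      · have := Multiset.map_le_map (f := (· + c)) hU
        simpa using this
      · simp [Multiset.sum_map_add, hUs, hUn])
  rw [hcnt, zero_add] at h0
  rw [hcnt, hcnt] at hor
  refine ⟨c, b + c, by simpa using hb, h0, ?_⟩
  rwa [show 2 * (b + c) - c = 2 * b + c by ring]
end
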